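/- arXiv:1507.04528 — 3 statements merged into one kernel-verified Lean document; each statement's English description precedes it below -/
import Mathlib

section
/- Let ρ: (0,∞)→[0,∞) be measurable with ∫_0^∞ min(1,s) ρ(s) ds < ∞ and ∫_0^∞ ρ(s) ds = +∞, and let κ > 0. Fix an integer k ≥ 1 and positive integers n_1,…,n_k with n = n_1+⋯+n_k. For ε > 0 define p_ε(n_1,…,n_k) = ∫_0^∞ [ (u^{n−1}/Γ(n)) · ((k+Λ_{ε,u})/Λ_ε) · exp(Λ_{ε,u} − Λ_ε) · ∏_{i=1}^k κ ∫_ε^∞ s^{n_i} e^{−u s} ρ(s) ds ] du, and define p_0(n_1,…,n_k) = ∫_0^∞ [ (u^{n−1}/Γ(n)) · exp( κ ∫_0^∞ (e^{−u s} − 1) ρ(s) ds ) · ∏_{i=1}^k κ ∫_0^∞ s^{n_i} e^{−u s} ρ(s) ds ] du. Then lim_{ε→0+} p_ε(n_1,…,n_k) = p_0(n_1,…,n_k). -/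
open MeasureTheory Filter Topology Set

section DominatedConvergence

variable {α ι : Type*} [MeasurableSpace α] {μ : Measure α} {l : Filter ι}

/-- A dominated convergence theorem in which the dominating functions `G i` vary with `i`. -/
theorem tendsto_integral_of_le_of_integral_le [l.IsCountablyGenerated]
    {f G : ι → α → ℝ} {f₀ G₀ : α → ℝ}
    (hf_meas : ∀ᶠ i in l, AEStronglyMeasurable (f i) μ)
    (hf_nonneg : ∀ᶠ i in l, ∀ᵐ a ∂μ, 0 ≤ f i a)
    (hfG : ∀ᶠ i in l, ∀ᵐ a ∂μ, f i a ≤ G i a)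
    (hG_int : ∀ᶠ i in l, Integrable (G i) μ)
    (hG₀_nonneg : ∀ᵐ a ∂μ, 0 ≤ G₀ a)
    (hfG₀ : ∀ᵐ a ∂μ, f₀ a ≤ G₀ a)
    (hG₀_int : Integrable G₀ μ)
    (hle : ∀ᶠ i in l, ∫ a, G i a ∂μ ≤ ∫ a, G₀ a ∂μ)
    (hf : ∀ᵐ a ∂μ, Tendsto (fun i => f i a) l (𝓝 (f₀ a)))
    (hG : ∀ᵐ a ∂μ, Tendsto (fun i => G i a) l (𝓝 (G₀ a))) :
    Tendsto (fun i => ∫ a, f i a ∂μ) l (𝓝 (∫ a, f₀ a ∂μ)) := by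
  have hmin : Tendsto (fun i => ∫ a, min (f i a) (G₀ a) ∂μ) l (𝓝 (∫ a, f₀ a ∂μ)) := by
    refine tendsto_integral_filter_of_dominated_convergence G₀ ?_ ?_ hG₀_int ?_
    · filter_upwards [hf_meas] with i hi using hi.inf hG₀_int.aestronglyMeasurable
    · filter_upwards [hf_nonneg] with i hi
      filter_upwards [hi, hG₀_nonneg] with a h1 h2
      rw [Real.norm_of_nonneg (le_min h1 h2)]
      exact min_le_right _ _
    · filter_upwards [hf, hfG₀] with a h1 h2
      simpa [min_eq_left h2] using h1.min (tendsto_const_nhds (x := G₀ a))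
  have hdef : Tendsto (fun i => ∫ a, max (G₀ a - G i a) 0 ∂μ) l (𝓝 0) := by
    have h := tendsto_integral_filter_of_dominated_convergence (μ := μ) (l := l)
      (F := fun i a => max (G₀ a - G i a) 0) (f := fun _ => 0) G₀ ?_ ?_ hG₀_int ?_
    · simpa using h
    · filter_upwards [hG_int] with i hi using (hG₀_int.sub hi).pos_part.aestronglyMeasurable
    · filter_upwards [hf_nonneg, hfG] with i hi hi'
      filter_upwards [hi, hi', hG₀_nonneg] with a h1 h2 h3
      rw [Real.norm_of_nonneg (le_max_right _ _)]
      exact max_le (by linarith) h3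
    · filter_upwards [hG] with a ha
      simpa using ((tendsto_const_nhds (x := G₀ a)).sub ha).max (tendsto_const_nhds (x := (0 : ℝ)))
  have hexcess : Tendsto (fun i => ∫ a, f i a ∂μ - ∫ a, min (f i a) (G₀ a) ∂μ) l (𝓝 0) := by
    refine tendsto_of_tendsto_of_tendsto_of_le_of_le' tendsto_const_nhds hdef ?_ ?_
    all_goals
      filter_upwards [hf_meas, hf_nonneg, hfG, hG_int, hle] with i h1 h2 h3 h4 h5
      have hfi : Integrable (f i) μ := by
        refine h4.mono' h1 ?_
        filter_upwards [h2, h3] with a h h'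
        rwa [Real.norm_of_nonneg h]
      have hmi : Integrable (fun a => min (f i a) (G₀ a)) μ := hfi.inf hG₀_int
    · rw [sub_nonneg]
      exact integral_mono hmi hfi fun a => min_le_left _ _
    · have hp : Integrable (fun a => max (G₀ a - G i a) 0) μ := (hG₀_int.sub h4).pos_part
      have key : ∫ a, (f i a - min (f i a) (G₀ a)) ∂μ
          ≤ ∫ a, ((G i a - G₀ a) + max (G₀ a - G i a) 0) ∂μ := by
        refine integral_mono_ae (hfi.sub hmi) ((h4.sub hG₀_int).add hp) ?_
        filter_upwards [h3] with a h
        rcases le_total (f i a) (G₀ a) with h' | h'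
        · rw [min_eq_left h']
          linarith [le_max_left (G₀ a - G i a) 0]
        · rw [min_eq_right h']
          linarith [le_max_right (G₀ a - G i a) 0]
      have hadd : ∫ a, ((G i a - G₀ a) + max (G₀ a - G i a) 0) ∂μ
          = ∫ a, (G i a - G₀ a) ∂μ + ∫ a, max (G₀ a - G i a) 0 ∂μ :=
        integral_add (h4.sub hG₀_int) hp
      rw [hadd, integral_sub hfi hmi, integral_sub h4 hG₀_int] at key
      linarith
  simpa using hexcess.add hmin

end DominatedConvergence

section ExponentialBounds

theorem mul_exp_neg_le_one_sub_exp_neg (x : ℝ) : x * Real.exp (-x) ≤ 1 - Real.exp (-x) := by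
  have h1 := mul_le_mul_of_nonneg_right (Real.add_one_le_exp x) (Real.exp_pos (-x)).le
  rw [← Real.exp_add, add_neg_cancel, Real.exp_zero] at h1
  linarith

theorem pow_mul_exp_neg_half_le {x : ℝ} (hx : 0 ≤ x) (m : ℕ) :
    x ^ m * Real.exp (-(x / 2)) ≤ 2 ^ m * m.factorial := by
  have h := Real.pow_div_factorial_le_exp (x / 2) (div_nonneg hx zero_le_two) m
  rw [div_pow, div_div, div_le_iff₀ (by positivity)] at h
  calc x ^ m * Real.exp (-(x / 2))
      ≤ (Real.exp (x / 2) * (2 ^ m * m.factorial)) * Real.exp (-(x / 2)) := by gcongr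
    _ = 2 ^ m * m.factorial * (Real.exp (x / 2) * Real.exp (-(x / 2))) := by ring
    _ = 2 ^ m * m.factorial := by rw [← Real.exp_add, add_neg_cancel, Real.exp_zero, mul_one]

theorem one_sub_exp_neg_mul_le {u s : ℝ} (hs : 0 ≤ s) :
    1 - Real.exp (-u * s) ≤ max 1 u * min 1 s := by
  have h1 : 1 - Real.exp (-u * s) ≤ 1 := by linarith [Real.exp_pos (-u * s)]
  have h2 : 1 - Real.exp (-u * s) ≤ u * s := by linarith [Real.add_one_le_exp (-u * s)]
  rcases le_total 1 s with h | h
  · rw [min_eq_left h, mul_one]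
    exact h1.trans (le_max_left _ _)
  · rw [min_eq_right h]
    exact h2.trans (mul_le_mul_of_nonneg_right (le_max_right _ _) hs)

theorem one_sub_exp_neg_mul_nonneg {u s : ℝ} (hu : 0 ≤ u) (hs : 0 ≤ s) :
    0 ≤ 1 - Real.exp (-u * s) := by
  rw [sub_nonneg, Real.exp_le_one_iff]
  nlinarith [mul_nonneg hu hs]

theorem pow_mul_pow_succ_mul_exp_le {u s : ℝ} (hu : 0 ≤ u) (hs : 0 ≤ s) (m : ℕ) :
    u ^ m * (s ^ (m + 1) * Real.exp (-u * s))
      ≤ 2 ^ m * m.factorial * (s ^ 1 * Real.exp (-(u / 2) * s)) := by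
  have h := mul_le_mul_of_nonneg_right (pow_mul_exp_neg_half_le (mul_nonneg hu hs) m)
    (mul_nonneg hs (Real.exp_pos (-(u / 2) * s)).le)
  have e : Real.exp (-u * s) = Real.exp (-(u * s / 2)) * Real.exp (-(u / 2) * s) := by
    rw [← Real.exp_add]
    ring_nf
  calc u ^ m * (s ^ (m + 1) * Real.exp (-u * s))
      = (u * s) ^ m * Real.exp (-(u * s / 2)) * (s * Real.exp (-(u / 2) * s)) := by
        rw [e]; ring
    _ ≤ _ := h
    _ = _ := by ring

end ExponentialBounds

/-- The Laplace exponent of a completely random measure with jump intensity `μ`. -/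
noncomputable def laplaceExponent (μ : Measure ℝ) (u : ℝ) : ℝ :=
  ∫ s, (1 - Real.exp (-u * s)) ∂μ

/-- The exponentially tilted moment `∫ s ^ j e ^ (-u s) μ(ds)`. -/
noncomputable def tiltedMoment (μ : Measure ℝ) (j : ℕ) (u : ℝ) : ℝ :=
  ∫ s, s ^ j * Real.exp (-u * s) ∂μ

section Laplace

variable {μ : Measure ℝ}

theorem integrable_one_sub_exp (hpos : ∀ᵐ s ∂μ, 0 < s) (hint : Integrable (fun s => min 1 s) μ)
    {u : ℝ} (hu : 0 ≤ u) : Integrable (fun s => 1 - Real.exp (-u * s)) μ := by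
  refine (hint.const_mul (max 1 u)).mono' (by fun_prop) ?_
  filter_upwards [hpos] with s hs
  rw [Real.norm_of_nonneg (one_sub_exp_neg_mul_nonneg hu hs.le)]
  exact one_sub_exp_neg_mul_le hs.le

theorem integrable_id_mul_exp (hpos : ∀ᵐ s ∂μ, 0 < s) (hint : Integrable (fun s => min 1 s) μ)
    {u : ℝ} (hu : 0 < u) : Integrable (fun s => s ^ 1 * Real.exp (-u * s)) μ := by
  refine ((integrable_one_sub_exp hpos hint hu.le).const_mul u⁻¹).mono' (by fun_prop) ?_
  filter_upwards [hpos] with s hs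
  rw [Real.norm_of_nonneg (by positivity), ← div_eq_inv_mul, le_div_iff₀ hu]
  have h := mul_exp_neg_le_one_sub_exp_neg (u * s)
  rw [← neg_mul] at h
  linarith

theorem integrable_pow_mul_exp (hpos : ∀ᵐ s ∂μ, 0 < s) (hint : Integrable (fun s => min 1 s) μ)
    {u : ℝ} (hu : 0 < u) {j : ℕ} (hj : 1 ≤ j) :
    Integrable (fun s => s ^ j * Real.exp (-u * s)) μ := by
  obtain ⟨m, rfl⟩ := Nat.exists_eq_add_of_le' hj
  refine (((integrable_id_mul_exp hpos hint (half_pos hu)).const_mul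
    (2 ^ m * m.factorial : ℝ)).const_mul (u ^ m)⁻¹).mono' (by fun_prop) ?_
  filter_upwards [hpos] with s hs
  rw [Real.norm_of_nonneg (by positivity), ← div_eq_inv_mul, le_div_iff₀ (by positivity), mul_comm]
  exact pow_mul_pow_succ_mul_exp_le hu.le hs.le m

theorem laplaceExponent_nonneg (hpos : ∀ᵐ s ∂μ, 0 < s) {u : ℝ} (hu : 0 ≤ u) :
    0 ≤ laplaceExponent μ u := by
  refine integral_nonneg_of_ae ?_
  filter_upwards [hpos] with s hs using one_sub_exp_neg_mul_nonneg hu hs.le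

theorem laplaceExponent_mono (hpos : ∀ᵐ s ∂μ, 0 < s) (hint : Integrable (fun s => min 1 s) μ)
    {u v : ℝ} (hu : 0 ≤ u) (huv : u ≤ v) : laplaceExponent μ u ≤ laplaceExponent μ v := by
  refine integral_mono_ae (integrable_one_sub_exp hpos hint hu)
    (integrable_one_sub_exp hpos hint (hu.trans huv)) ?_
  filter_upwards [hpos] with s hs
  have : -v * s ≤ -u * s := by nlinarith
  linarith [Real.exp_le_exp.2 this]

theorem tiltedMoment_nonneg (hpos : ∀ᵐ s ∂μ, 0 < s) (j : ℕ) (u : ℝ) : 0 ≤ tiltedMoment μ j u := by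
  refine integral_nonneg_of_ae ?_
  filter_upwards [hpos] with s hs
  positivity

theorem mul_tiltedMoment_one_le (hpos : ∀ᵐ s ∂μ, 0 < s) (hint : Integrable (fun s => min 1 s) μ)
    {u : ℝ} (hu : 0 < u) : u * tiltedMoment μ 1 u ≤ laplaceExponent μ u := by
  rw [tiltedMoment, ← integral_const_mul]
  refine integral_mono ((integrable_id_mul_exp hpos hint hu).const_mul u)
    (integrable_one_sub_exp hpos hint hu.le) fun s => ?_
  have h := mul_exp_neg_le_one_sub_exp_neg (u * s)
  rw [← neg_mul] at h
  dsimp only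
  linarith

theorem pow_mul_tiltedMoment_le (hpos : ∀ᵐ s ∂μ, 0 < s) (hint : Integrable (fun s => min 1 s) μ)
    {u : ℝ} (hu : 0 < u) {j : ℕ} (hj : 1 ≤ j) :
    u ^ (j - 1) * tiltedMoment μ j u
      ≤ 2 ^ (j - 1) * (j - 1).factorial * tiltedMoment μ 1 (u / 2) := by
  obtain ⟨m, rfl⟩ := Nat.exists_eq_add_of_le' hj
  rw [Nat.add_sub_cancel, tiltedMoment, tiltedMoment, ← integral_const_mul, ← integral_const_mul]
  refine integral_mono_ae ((integrable_pow_mul_exp hpos hint hu hj).const_mul _)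
    ((integrable_id_mul_exp hpos hint (half_pos hu)).const_mul _) ?_
  filter_upwards [hpos] with s hs using pow_mul_pow_succ_mul_exp_le hu.le hs.le m

theorem measurable_laplaceExponent [SFinite μ] : Measurable (laplaceExponent μ) := by
  refine (StronglyMeasurable.integral_prod_right (ν := μ)
    (f := fun u s : ℝ => 1 - Real.exp (-u * s)) ?_).measurable
  exact Continuous.stronglyMeasurable (by fun_prop)

theorem measurable_tiltedMoment [SFinite μ] (j : ℕ) : Measurable (tiltedMoment μ j) := by
  refine (StronglyMeasurable.integral_prod_right (ν := μ)
    (f := fun u s : ℝ => s ^ j * Real.exp (-u * s)) ?_).measurable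
  exact Continuous.stronglyMeasurable (by fun_prop)

theorem hasDerivAt_laplaceExponent (hpos : ∀ᵐ s ∂μ, 0 < s)
    (hint : Integrable (fun s => min 1 s) μ) {u : ℝ} (hu : 0 < u) :
    HasDerivAt (laplaceExponent μ) (tiltedMoment μ 1 u) u := by
  refine (hasDerivAt_integral_of_dominated_loc_of_deriv_le (μ := μ)
    (F := fun v s : ℝ => 1 - Real.exp (-v * s)) (F' := fun v s => s ^ 1 * Real.exp (-v * s))
    (s := Ioi (u / 2)) (bound := fun s => s ^ 1 * Real.exp (-(u / 2) * s))
    (Ioi_mem_nhds (half_lt_self hu)) (Eventually.of_forall fun v => by fun_prop)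
    (integrable_one_sub_exp hpos hint hu.le) (by fun_prop) ?_
    (integrable_id_mul_exp hpos hint (half_pos hu)) ?_).2
  · filter_upwards [hpos] with s hs v hv
    rw [Real.norm_of_nonneg (by positivity)]
    have : -v * s ≤ -(u / 2) * s := by nlinarith [mem_Ioi.1 hv]
    gcongr
  · refine Eventually.of_forall fun s v _ => ?_
    have h := (((hasDerivAt_id v).neg.mul_const s).exp).const_sub 1
    simpa [mul_comm] using h

theorem continuousWithinAt_laplaceExponent_zero (hpos : ∀ᵐ s ∂μ, 0 < s)
    (hint : Integrable (fun s => min 1 s) μ) :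
    ContinuousWithinAt (laplaceExponent μ) (Ici 0) 0 := by
  refine continuousWithinAt_of_dominated (μ := μ) (F := fun v s : ℝ => 1 - Real.exp (-v * s))
    (bound := fun s => min 1 s) (Eventually.of_forall fun v => by fun_prop) ?_ hint
    (Eventually.of_forall fun s => by fun_prop)
  filter_upwards [self_mem_nhdsWithin, mem_nhdsWithin_of_mem_nhds (Iic_mem_nhds one_pos)]
    with v hv hv1
  filter_upwards [hpos] with s hs
  rw [Real.norm_of_nonneg (one_sub_exp_neg_mul_nonneg hv hs.le)]
  simpa [max_eq_left (mem_Iic.1 hv1)] using one_sub_exp_neg_mul_le (u := v) hs.le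

@[simp]
theorem laplaceExponent_zero : laplaceExponent μ 0 = 0 := by simp [laplaceExponent]

theorem exists_tendsto_exp_neg_laplaceExponent (hpos : ∀ᵐ s ∂μ, 0 < s)
    (hint : Integrable (fun s => min 1 s) μ) :
    ∃ c, 0 ≤ c ∧ Tendsto (fun u => Real.exp (-(laplaceExponent μ (u / 2) / 2))) atTop (𝓝 c) := by
  set g : ℝ → ℝ := fun u => Real.exp (-(laplaceExponent μ (max u 0 / 2) / 2)) with hg
  have hanti : Antitone g := fun u v huv => by
    have := laplaceExponent_mono hpos hint (u := max u 0 / 2) (v := max v 0 / 2)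
      (by positivity) (by gcongr)
    simp only [hg]
    gcongr
  have hlim := tendsto_atTop_ciInf hanti ⟨0, by rintro _ ⟨u, rfl⟩; exact (Real.exp_pos _).le⟩
  refine ⟨_, le_ciInf fun u => (Real.exp_pos _).le, hlim.congr' ?_⟩
  filter_upwards [eventually_ge_atTop 0] with u hu
  simp [hg, max_eq_left hu]

theorem tendsto_laplaceExponent_nat (hpos : ∀ᵐ s ∂μ, 0 < s)
    (hint : Integrable (fun s => min 1 s) μ) (hinf : μ univ = ⊤) :
    Tendsto (fun n : ℕ => laplaceExponent μ n) atTop atTop := by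
  rw [← ENNReal.tendsto_ofReal_nhds_top]
  have h : Tendsto (fun n : ℕ => ∫⁻ s, ENNReal.ofReal (1 - Real.exp (-(n : ℝ) * s)) ∂μ) atTop
      (𝓝 (∫⁻ _, 1 ∂μ)) := by
    refine lintegral_tendsto_of_tendsto_of_monotone (fun n => by fun_prop) ?_ ?_
    · filter_upwards [hpos] with s hs m n hmn
      have : (m : ℝ) ≤ n := by exact_mod_cast hmn
      refine ENNReal.ofReal_le_ofReal (sub_le_sub_left (Real.exp_le_exp.2 ?_) 1)
      nlinarith
    · filter_upwards [hpos] with s hs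
      have h1 : Tendsto (fun n : ℕ => -(n : ℝ) * s) atTop atBot := by
        simpa only [neg_mul, Function.comp_def] using
          tendsto_neg_atTop_atBot.comp (tendsto_natCast_atTop_atTop.atTop_mul_const hs)
      simpa using ENNReal.tendsto_ofReal ((Real.tendsto_exp_atBot.comp h1).const_sub 1)
  rw [lintegral_one, hinf] at h
  refine h.congr fun n => ?_
  rw [laplaceExponent, ofReal_integral_eq_lintegral_ofReal
    (integrable_one_sub_exp hpos hint n.cast_nonneg)]
  filter_upwards [hpos] with s hs using one_sub_exp_neg_mul_nonneg n.cast_nonneg hs.le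

theorem tendsto_exp_neg_laplaceExponent (hpos : ∀ᵐ s ∂μ, 0 < s)
    (hint : Integrable (fun s => min 1 s) μ) (hinf : μ univ = ⊤) :
    Tendsto (fun u => Real.exp (-(laplaceExponent μ (u / 2) / 2))) atTop (𝓝 0) := by
  obtain ⟨c, -, hc⟩ := exists_tendsto_exp_neg_laplaceExponent hpos hint
  have h1 : Tendsto (fun n : ℕ => (2 * n : ℝ)) atTop atTop :=
    tendsto_natCast_atTop_atTop.const_mul_atTop two_pos
  have h2 : Tendsto (fun n : ℕ => Real.exp (-(laplaceExponent μ n / 2))) atTop (𝓝 0) :=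
    Real.tendsto_exp_neg_atTop_nhds_zero.comp
      ((tendsto_laplaceExponent_nat hpos hint hinf).atTop_div_const two_pos)
  have h3 : Tendsto (fun n : ℕ => Real.exp (-(laplaceExponent μ n / 2))) atTop (𝓝 c) := by
    refine (hc.comp h1).congr fun n => ?_
    simp
  rwa [tendsto_nhds_unique h3 h2] at hc

/-- An integrable bound, up to a constant, for the integrand of the eppf; it is the derivative of
`-4 exp (-ψ (u / 2) / 2)`, with `ψ` the Laplace exponent. -/
noncomputable def eppfBound (μ : Measure ℝ) (u : ℝ) : ℝ :=
  tiltedMoment μ 1 (u / 2) * Real.exp (-(laplaceExponent μ (u / 2) / 2))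

theorem eppfBound_nonneg (hpos : ∀ᵐ s ∂μ, 0 < s) (u : ℝ) : 0 ≤ eppfBound μ u := by
  have := tiltedMoment_nonneg hpos 1 (u / 2)
  unfold eppfBound
  positivity

theorem integrableOn_eppfBound_and_integral_eq (hpos : ∀ᵐ s ∂μ, 0 < s)
    (hint : Integrable (fun s => min 1 s) μ) {c : ℝ}
    (hc : Tendsto (fun u => Real.exp (-(laplaceExponent μ (u / 2) / 2))) atTop (𝓝 c)) :
    IntegrableOn (eppfBound μ) (Ioi 0) ∧ ∫ u in Ioi 0, eppfBound μ u = 4 * (1 - c) := by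
  have hcont : ContinuousWithinAt (fun u => -4 * Real.exp (-(laplaceExponent μ (u / 2) / 2)))
      (Ici 0) 0 := by
    have h0 := continuousWithinAt_laplaceExponent_zero hpos hint
    have h1 : ContinuousWithinAt (fun u => laplaceExponent μ (u / 2)) (Ici 0) 0 := by
      refine ContinuousWithinAt.comp (g := laplaceExponent μ) (f := fun u : ℝ => u / 2)
        (t := Ici 0) (by simpa using h0) (by fun_prop) fun u (hu : 0 ≤ u) => ?_
      exact div_nonneg hu two_pos.le
    exact ((h1.div_const 2).neg.rexp).const_mul (-4)
  have hderiv : ∀ u ∈ Ioi (0 : ℝ), HasDerivAt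
      (fun u => -4 * Real.exp (-(laplaceExponent μ (u / 2) / 2))) (eppfBound μ u) u := by
    intro u hu
    have h := (hasDerivAt_laplaceExponent hpos hint (half_pos (mem_Ioi.1 hu))).comp u
      ((hasDerivAt_id u).div_const 2)
    refine (((h.div_const 2).fun_neg.exp).const_mul (-4)).congr_deriv ?_
    simp only [Function.comp_apply, id, eppfBound]
    ring
  have hnn : ∀ u ∈ Ioi (0 : ℝ), 0 ≤ eppfBound μ u := fun u _ => eppfBound_nonneg hpos u
  have hlim := hc.const_mul (-4)
  refine ⟨integrableOn_Ioi_deriv_of_nonneg hcont hderiv hnn hlim, ?_⟩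
  rw [integral_Ioi_of_hasDerivAt_of_nonneg hcont hderiv hnn hlim]
  simp
  ring

theorem exists_eppf_integrand_le {k : ℕ} (hk : 1 ≤ k) (nv : Fin k → ℕ) (hnv : ∀ i, 1 ≤ nv i) :
    ∃ C : ℝ, 0 ≤ C ∧ ∀ μ : Measure ℝ, (∀ᵐ s ∂μ, 0 < s) → Integrable (fun s => min 1 s) μ →
      ∀ u, 0 < u → u ^ ((∑ i, nv i) - 1) * Real.exp (-laplaceExponent μ u) *
        ∏ i, tiltedMoment μ (nv i) u ≤ C * eppfBound μ u := by
  obtain ⟨m, rfl⟩ := Nat.exists_eq_add_of_le' hk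
  refine ⟨(∏ i, (2 ^ (nv i - 1) * (nv i - 1).factorial : ℝ)) * 2 ^ m * (2 ^ m * m.factorial),
    by positivity, fun μ hpos hint u hu => ?_⟩
  set A : ℝ := ∏ i, (2 ^ (nv i - 1) * (nv i - 1).factorial : ℝ) with hA
  set φ := tiltedMoment μ 1 (u / 2) with hφ
  set ψ := laplaceExponent μ (u / 2) with hψ
  have hu2 : 0 < u / 2 := half_pos hu
  have hφ0 : 0 ≤ φ := tiltedMoment_nonneg hpos 1 _
  have hψ0 : 0 ≤ ψ := laplaceExponent_nonneg hpos hu2.le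
  have hsum : (∑ i, nv i) - 1 = m + ∑ i, (nv i - 1) := by
    have h : ∑ i, nv i = ∑ i, ((nv i - 1) + 1) :=
      Finset.sum_congr rfl fun i _ => (Nat.sub_add_cancel (hnv i)).symm
    rw [h, Finset.sum_add_distrib]
    simp
    omega
  have hprod : u ^ (∑ i, (nv i - 1)) * ∏ i, tiltedMoment μ (nv i) u ≤ A * φ ^ (m + 1) := by
    rw [← Finset.prod_pow_eq_pow_sum, ← Finset.prod_mul_distrib]
    calc ∏ i, u ^ (nv i - 1) * tiltedMoment μ (nv i) u
        ≤ ∏ i, (2 ^ (nv i - 1) * (nv i - 1).factorial : ℝ) * φ := by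
          refine Finset.prod_le_prod (fun i _ => ?_)
            fun i _ => pow_mul_tiltedMoment_le hpos hint hu (hnv i)
          have := tiltedMoment_nonneg hpos (nv i) u
          positivity
      _ = A * φ ^ (m + 1) := by simp [Finset.prod_mul_distrib, hA]
  have hmom : u ^ m * φ ^ m ≤ 2 ^ m * ψ ^ m := by
    rw [← mul_pow, ← mul_pow]
    have := mul_tiltedMoment_one_le hpos hint hu2
    exact pow_le_pow_left₀ (by positivity) (by linarith) m
  have hexp : Real.exp (-laplaceExponent μ u) ≤ Real.exp (-(ψ / 2)) * Real.exp (-(ψ / 2)) := by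
    rw [← Real.exp_add, Real.exp_le_exp]
    linarith [laplaceExponent_mono hpos hint hu2.le (half_le_self hu.le)]
  have hpoly := pow_mul_exp_neg_half_le hψ0 m
  have hprod0 : 0 ≤ u ^ (∑ i, (nv i - 1)) * ∏ i, tiltedMoment μ (nv i) u :=
    mul_nonneg (by positivity) (Finset.prod_nonneg fun i _ => tiltedMoment_nonneg hpos _ _)
  have hA0 : 0 ≤ A := by positivity
  calc u ^ ((∑ i, nv i) - 1) * Real.exp (-laplaceExponent μ u) * ∏ i, tiltedMoment μ (nv i) u
      = u ^ m * Real.exp (-laplaceExponent μ u) *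
          (u ^ (∑ i, (nv i - 1)) * ∏ i, tiltedMoment μ (nv i) u) := by rw [hsum, pow_add]; ring
    _ ≤ u ^ m * (Real.exp (-(ψ / 2)) * Real.exp (-(ψ / 2))) * (A * φ ^ (m + 1)) := by gcongr
    _ = (u ^ m * φ ^ m) * (A * φ * Real.exp (-(ψ / 2)) * Real.exp (-(ψ / 2))) := by ring
    _ ≤ (2 ^ m * ψ ^ m) * (A * φ * Real.exp (-(ψ / 2)) * Real.exp (-(ψ / 2))) := by gcongr
    _ = (ψ ^ m * Real.exp (-(ψ / 2))) * (A * 2 ^ m * φ * Real.exp (-(ψ / 2))) := by ring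
    _ ≤ (2 ^ m * m.factorial) * (A * 2 ^ m * φ * Real.exp (-(ψ / 2))) := by gcongr
    _ = _ := by rw [eppfBound]; ring

end Laplace

section Truncation

variable {ν : Measure ℝ}

theorem isFiniteMeasure_restrict_Ioi (hint : Integrable (fun s => min 1 s) ν) {ε : ℝ}
    (hε : 0 < ε) : IsFiniteMeasure (ν.restrict (Ioi ε)) := by
  have h : Integrable (fun _ : ℝ => min 1 ε) (ν.restrict (Ioi ε)) := by
    refine hint.restrict.mono' (by fun_prop) ?_
    filter_upwards [ae_restrict_mem measurableSet_Ioi] with s hs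
    rw [Real.norm_of_nonneg (by positivity)]
    exact min_le_min_left 1 (mem_Ioi.1 hs).le
  have hne : min 1 ε ≠ 0 := (lt_min one_pos hε).ne'
  simpa [integrable_const_iff, hne] using h

theorem aecover_Ioi_nhdsGT_zero (hpos : ∀ᵐ s ∂ν, 0 < s) :
    AECover ν (𝓝[>] (0 : ℝ)) fun ε => Ioi ε where
  ae_eventually_mem := by
    filter_upwards [hpos] with s hs
    exact mem_nhdsWithin_of_mem_nhds (Iio_mem_nhds hs)
  measurableSet _ := measurableSet_Ioi

theorem tendsto_laplaceExponent_restrict (hpos : ∀ᵐ s ∂ν, 0 < s)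
    (hint : Integrable (fun s => min 1 s) ν) {u : ℝ} (hu : 0 ≤ u) :
    Tendsto (fun ε => laplaceExponent (ν.restrict (Ioi ε)) u) (𝓝[>] 0)
      (𝓝 (laplaceExponent ν u)) :=
  (aecover_Ioi_nhdsGT_zero hpos).integral_tendsto_of_countably_generated
    (integrable_one_sub_exp hpos hint hu)

theorem tendsto_tiltedMoment_restrict (hpos : ∀ᵐ s ∂ν, 0 < s)
    (hint : Integrable (fun s => min 1 s) ν) {u : ℝ} (hu : 0 < u) {j : ℕ} (hj : 1 ≤ j) :
    Tendsto (fun ε => tiltedMoment (ν.restrict (Ioi ε)) j u) (𝓝[>] 0)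
      (𝓝 (tiltedMoment ν j u)) :=
  (aecover_Ioi_nhdsGT_zero hpos).integral_tendsto_of_countably_generated
    (integrable_pow_mul_exp hpos hint hu hj)

theorem tendsto_measureReal_restrict (hpos : ∀ᵐ s ∂ν, 0 < s)
    (hint : Integrable (fun s => min 1 s) ν) (hinf : ν univ = ⊤) :
    Tendsto (fun ε => (ν.restrict (Ioi ε)).real univ) (𝓝[>] 0) atTop := by
  rw [← ENNReal.tendsto_ofReal_nhds_top, ← hinf]
  have h := (aecover_Ioi_nhdsGT_zero hpos).lintegral_tendsto_of_countably_generated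
    (f := fun _ => 1) aemeasurable_const
  rw [lintegral_one] at h
  refine h.congr' ?_
  filter_upwards [self_mem_nhdsWithin] with ε hε
  have := isFiniteMeasure_restrict_Ioi hint (mem_Ioi.1 hε)
  rw [lintegral_one, ofReal_measureReal]

theorem tiltedMoment_zero_eq {μ : Measure ℝ} [IsFiniteMeasure μ] (hpos : ∀ᵐ s ∂μ, 0 < s)
    (hint : Integrable (fun s => min 1 s) μ) {u : ℝ} (hu : 0 ≤ u) :
    tiltedMoment μ 0 u = μ.real univ - laplaceExponent μ u := by
  have h := integral_sub (integrable_const (μ := μ) (1 : ℝ))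
    (integrable_one_sub_exp hpos hint hu)
  simpa [tiltedMoment, laplaceExponent] using h

/-- Convergence of the eppf of the truncated Lévy measures, for a general Lévy measure `ν`. -/
theorem tendsto_integral_eppf_restrict [SFinite ν] (hpos : ∀ᵐ s ∂ν, 0 < s)
    (hint : Integrable (fun s => min 1 s) ν) (hinf : ν univ = ⊤)
    {k : ℕ} (hk : 1 ≤ k) (nv : Fin k → ℕ) (hnv : ∀ i, 1 ≤ nv i) {c : ℝ} (hc : 0 < c) :
    Tendsto (fun ε => ∫ u in Ioi (0 : ℝ), u ^ ((∑ i, nv i) - 1) / c *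
        ((k + tiltedMoment (ν.restrict (Ioi ε)) 0 u) / (ν.restrict (Ioi ε)).real univ) *
        Real.exp (tiltedMoment (ν.restrict (Ioi ε)) 0 u - (ν.restrict (Ioi ε)).real univ) *
        ∏ i, tiltedMoment (ν.restrict (Ioi ε)) (nv i) u) (𝓝[>] 0)
      (𝓝 (∫ u in Ioi (0 : ℝ), u ^ ((∑ i, nv i) - 1) / c * Real.exp (-laplaceExponent ν u) *
        ∏ i, tiltedMoment ν (nv i) u)) := by
  obtain ⟨C, hC0, hC⟩ := exists_eppf_integrand_le hk nv hnv
  have hposr : ∀ ε : ℝ, ∀ᵐ s ∂ν.restrict (Ioi ε), 0 < s := fun ε => ae_restrict_of_ae hpos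
  have hintr : ∀ ε : ℝ, Integrable (fun s => min 1 s) (ν.restrict (Ioi ε)) :=
    fun ε => hint.restrict
  have hprod : ∀ μ : Measure ℝ, (∀ᵐ s ∂μ, 0 < s) → ∀ u, 0 ≤ ∏ i, tiltedMoment μ (nv i) u :=
    fun μ h u => Finset.prod_nonneg fun i _ => tiltedMoment_nonneg h _ _
  have hmass := tendsto_measureReal_restrict hpos hint hinf
  have hG₀ := integrableOn_eppfBound_and_integral_eq hpos hint
    (tendsto_exp_neg_laplaceExponent hpos hint hinf)
  set D : ℝ := (k + 1) * (C / c) with hD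
  have hCc : 0 ≤ C / c := by positivity
  have hD0 : 0 ≤ D := by positivity
  refine tendsto_integral_of_le_of_integral_le
    (G := fun ε u => D * eppfBound (ν.restrict (Ioi ε)) u) (G₀ := fun u => D * eppfBound ν u)
    ?_ ?_ ?_ ?_ ?_ ?_ ?_ ?_ ?_ ?_
  · refine Eventually.of_forall fun ε => Measurable.aestronglyMeasurable ?_
    have h0 := measurable_tiltedMoment (μ := ν.restrict (Ioi ε)) 0
    have hi := fun i => measurable_tiltedMoment (μ := ν.restrict (Ioi ε)) (nv i)
    fun_prop
  · refine Eventually.of_forall fun ε => ?_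
    filter_upwards [ae_restrict_mem measurableSet_Ioi] with u hu
    have hu0 : 0 < u := hu
    have h0 := tiltedMoment_nonneg (hposr ε) 0 u
    have h1 := hprod _ (hposr ε) u
    positivity
  · filter_upwards [self_mem_nhdsWithin, hmass.eventually_ge_atTop 1] with ε hε hmass1
    have := isFiniteMeasure_restrict_Ioi hint (mem_Ioi.1 hε)
    filter_upwards [ae_restrict_mem measurableSet_Ioi] with u hu
    have hu0 : 0 < u := hu
    have hψ := laplaceExponent_nonneg (hposr ε) hu0.le
    have hprod' := hprod _ (hposr ε) u
    have hCu := hC _ (hposr ε) (hintr ε) u hu0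
    rw [tiltedMoment_zero_eq (hposr ε) (hintr ε) hu0.le]
    set L := (ν.restrict (Ioi ε)).real univ
    set ψ := laplaceExponent (ν.restrict (Ioi ε)) u
    have hratio : (k + (L - ψ)) / L ≤ k + 1 := by
      rw [div_le_iff₀ (by linarith)]
      nlinarith [mul_le_mul_of_nonneg_left hmass1 (Nat.cast_nonneg (α := ℝ) k)]
    have hexp : L - ψ - L = -ψ := by ring
    rw [hexp]
    calc u ^ ((∑ i, nv i) - 1) / c * ((k + (L - ψ)) / L) * Real.exp (-ψ) *
          ∏ i, tiltedMoment (ν.restrict (Ioi ε)) (nv i) u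
        ≤ u ^ ((∑ i, nv i) - 1) / c * (k + 1) * Real.exp (-ψ) *
          ∏ i, tiltedMoment (ν.restrict (Ioi ε)) (nv i) u := by gcongr
      _ = (k + 1) / c * (u ^ ((∑ i, nv i) - 1) * Real.exp (-ψ) *
          ∏ i, tiltedMoment (ν.restrict (Ioi ε)) (nv i) u) := by ring
      _ ≤ (k + 1) / c * (C * eppfBound (ν.restrict (Ioi ε)) u) := by gcongr
      _ = D * eppfBound (ν.restrict (Ioi ε)) u := by rw [hD]; ring
  · refine Eventually.of_forall fun ε => ?_
    obtain ⟨c', -, hc'⟩ := exists_tendsto_exp_neg_laplaceExponent (hposr ε) (hintr ε)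
    exact (integrableOn_eppfBound_and_integral_eq (hposr ε) (hintr ε) hc').1.const_mul D
  · exact Eventually.of_forall fun u => mul_nonneg hD0 (eppfBound_nonneg hpos u)
  · filter_upwards [ae_restrict_mem measurableSet_Ioi] with u hu
    have hCu := hC _ hpos hint u hu
    have hb := eppfBound_nonneg hpos u
    calc u ^ ((∑ i, nv i) - 1) / c * Real.exp (-laplaceExponent ν u) *
          ∏ i, tiltedMoment ν (nv i) u
        = (u ^ ((∑ i, nv i) - 1) * Real.exp (-laplaceExponent ν u) *
          ∏ i, tiltedMoment ν (nv i) u) / c := by ring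
      _ ≤ C * eppfBound ν u / c := by gcongr
      _ = 1 * (C / c * eppfBound ν u) := by ring
      _ ≤ (k + 1) * (C / c * eppfBound ν u) := by
          gcongr
          linarith [Nat.cast_nonneg (α := ℝ) k]
      _ = D * eppfBound ν u := by rw [hD]; ring
  · exact hG₀.1.const_mul D
  · refine Eventually.of_forall fun ε => ?_
    obtain ⟨c', hc'0, hc'⟩ := exists_tendsto_exp_neg_laplaceExponent (hposr ε) (hintr ε)
    rw [integral_const_mul, integral_const_mul, hG₀.2,
      (integrableOn_eppfBound_and_integral_eq (hposr ε) (hintr ε) hc').2]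
    gcongr
  · filter_upwards [ae_restrict_mem measurableSet_Ioi] with u hu
    have hu0 : 0 < u := hu
    have hψ := tendsto_laplaceExponent_restrict hpos hint hu0.le
    have hratio : Tendsto (fun ε => 1 + (k - laplaceExponent (ν.restrict (Ioi ε)) u) /
        (ν.restrict (Ioi ε)).real univ) (𝓝[>] 0) (𝓝 1) := by
      simpa using (hψ.const_sub (k : ℝ)).div_atTop hmass |>.const_add 1
    have hlim := ((hratio.const_mul (u ^ ((∑ i, nv i) - 1) / c)).mul hψ.neg.rexp).mul
      (tendsto_finsetProd Finset.univ fun i _ =>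
        tendsto_tiltedMoment_restrict hpos hint hu0 (hnv i))
    rw [mul_one] at hlim
    refine hlim.congr' ?_
    filter_upwards [self_mem_nhdsWithin, hmass.eventually_gt_atTop 0] with ε hε hmass0
    have := isFiniteMeasure_restrict_Ioi hint (mem_Ioi.1 hε)
    rw [tiltedMoment_zero_eq (hposr ε) (hintr ε) hu0.le]
    congr 2
    · congr 1
      field_simp
      ring
    · ring_nf
  · filter_upwards [ae_restrict_mem measurableSet_Ioi] with u hu
    have hu0 : 0 < u / 2 := half_pos hu
    exact ((tendsto_tiltedMoment_restrict hpos hint hu0 le_rfl).mul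
      ((tendsto_laplaceExponent_restrict hpos hint hu0.le).div_const 2).neg.rexp).const_mul D

end Truncation

section Density

/-- The Lévy measure on `(0, ∞)` with density `κ ρ`. -/
noncomputable def levyMeasure (ρ : ℝ → ℝ) (κ : ℝ) : Measure ℝ :=
  (volume.restrict (Ioi 0)).withDensity fun s => ENNReal.ofReal (κ * ρ s)

variable {ρ : ℝ → ℝ} {κ : ℝ}

instance : SFinite (levyMeasure ρ κ) := by
  unfold levyMeasure
  infer_instance

theorem ae_levyMeasure_pos : ∀ᵐ s ∂levyMeasure ρ κ, 0 < s :=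
  (withDensity_absolutelyContinuous _ _).ae_le (ae_restrict_mem measurableSet_Ioi)

theorem levyMeasure_univ (hκ : 0 < κ) (h : ∫⁻ s in Ioi (0 : ℝ), ENNReal.ofReal (ρ s) = ⊤) :
    levyMeasure ρ κ univ = ⊤ := by
  simp_rw [levyMeasure, withDensity_apply _ MeasurableSet.univ, Measure.restrict_univ,
    ENNReal.ofReal_mul hκ.le]
  rw [lintegral_const_mul' _ _ ENNReal.ofReal_ne_top, h]
  exact ENNReal.mul_top (by simpa using hκ)

theorem integrable_min_levyMeasure (hρ : Measurable ρ) (hκ : 0 < κ)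
    (h : ∫⁻ s in Ioi (0 : ℝ), ENNReal.ofReal (min 1 s * ρ s) < ⊤) :
    Integrable (fun s => min 1 s) (levyMeasure ρ κ) := by
  refine (lintegral_ofReal_ne_top_iff_integrable (by fun_prop) ?_).1 ?_
  · filter_upwards [ae_levyMeasure_pos] with s hs
    exact le_min zero_le_one hs.le
  · rw [levyMeasure, lintegral_withDensity_eq_lintegral_mul _ (by fun_prop) (by fun_prop)]
    have e : ∫⁻ s in Ioi (0 : ℝ),
          ((fun s => ENNReal.ofReal (κ * ρ s)) * fun s => ENNReal.ofReal (min 1 s)) s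
        = ∫⁻ s in Ioi (0 : ℝ), ENNReal.ofReal κ * ENNReal.ofReal (min 1 s * ρ s) := by
      refine setLIntegral_congr_fun measurableSet_Ioi fun s hs => ?_
      have hs' : 0 ≤ min 1 s := le_min zero_le_one (mem_Ioi.1 hs).le
      rw [Pi.mul_apply, ENNReal.ofReal_mul hκ.le, ENNReal.ofReal_mul hs']
      ring
    rw [e, lintegral_const_mul' _ _ ENNReal.ofReal_ne_top]
    exact ENNReal.mul_ne_top ENNReal.ofReal_ne_top h.ne

theorem setIntegral_levyMeasure (hρ : Measurable ρ) (hρnn : ∀ s ∈ Ioi (0 : ℝ), 0 ≤ ρ s)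
    (hκ : 0 < κ) (f : ℝ → ℝ) {ε : ℝ} (hε : 0 ≤ ε) :
    ∫ s in Ioi ε, f s ∂levyMeasure ρ κ = κ * ∫ s in Ioi ε, f s * ρ s := by
  rw [levyMeasure, restrict_withDensity measurableSet_Ioi,
    Measure.restrict_restrict measurableSet_Ioi, inter_eq_left.2 (Ioi_subset_Ioi hε),
    integral_withDensity_eq_integral_toReal_smul (by fun_prop)
      (Eventually.of_forall fun s => ENNReal.ofReal_lt_top), ← integral_const_mul]
  refine setIntegral_congr_fun measurableSet_Ioi fun s hs => ?_
  have : 0 ≤ κ * ρ s := mul_nonneg hκ.le (hρnn s (hε.trans_lt (mem_Ioi.1 hs)))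
  simp only [ENNReal.toReal_ofReal this, smul_eq_mul]
  ring

theorem restrict_levyMeasure_Ioi_zero :
    (levyMeasure ρ κ).restrict (Ioi 0) = levyMeasure ρ κ :=
  Measure.restrict_eq_self_of_ae_mem ae_levyMeasure_pos

end Density

/-- Pointwise limit of the eppf `p_ε` of the ε-approximated normalized
completely random measure to the eppf `p_0` of the limiting normalized CRM, as ε → 0⁺. -/
theorem eppf_tendsto_of_eps
    (ρ : ℝ → ℝ) (hρmeas : Measurable ρ) (hρnn : ∀ s ∈ Set.Ioi (0:ℝ), 0 ≤ ρ s)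
    (hreg1 : ∫⁻ s in Set.Ioi (0:ℝ), ENNReal.ofReal (min 1 s * ρ s) < ⊤)
    (hreg2 : ∫⁻ s in Set.Ioi (0:ℝ), ENNReal.ofReal (ρ s) = ⊤)
    (κ : ℝ) (hκ : 0 < κ)
    (k : ℕ) (hk : 1 ≤ k) (nv : Fin k → ℕ) (hnv : ∀ i, 1 ≤ nv i)
    (n : ℕ) (hn : n = ∑ i, nv i) :
    Filter.Tendsto
      (fun ε : ℝ =>
        ∫ u in Set.Ioi (0:ℝ),
          (u ^ (n - 1) / Real.Gamma n) *
            ((k + κ * ∫ s in Set.Ioi ε, Real.exp (-u * s) * ρ s) /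
              (κ * ∫ s in Set.Ioi ε, ρ s)) *
            Real.exp ((κ * ∫ s in Set.Ioi ε, Real.exp (-u * s) * ρ s) -
              (κ * ∫ s in Set.Ioi ε, ρ s)) *
            ∏ i, κ * ∫ s in Set.Ioi ε, s ^ (nv i) * Real.exp (-u * s) * ρ s)
      (𝓝[>] (0:ℝ))
      (𝓝 (∫ u in Set.Ioi (0:ℝ),
        (u ^ (n - 1) / Real.Gamma n) *
          Real.exp (κ * ∫ s in Set.Ioi (0:ℝ), (Real.exp (-u * s) - 1) * ρ s) *
          ∏ i, κ * ∫ s in Set.Ioi (0:ℝ), s ^ (nv i) * Real.exp (-u * s) * ρ s)) := by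
  subst hn
  have hn1 : 1 ≤ ∑ i, nv i :=
    (hnv ⟨0, hk⟩).trans (Finset.single_le_sum (fun i _ => Nat.zero_le (nv i)) (Finset.mem_univ _))
  have hΓ : 0 < Real.Gamma ((∑ i, nv i : ℕ) : ℝ) := Real.Gamma_pos_of_pos (by exact_mod_cast hn1)
  have hset := fun (f : ℝ → ℝ) {ε : ℝ} (hε : 0 ≤ ε) =>
    setIntegral_levyMeasure hρmeas hρnn hκ f hε
  have hmoment : ∀ ε : ℝ, 0 ≤ ε → ∀ j u, tiltedMoment ((levyMeasure ρ κ).restrict (Ioi ε)) j u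
      = κ * ∫ s in Ioi ε, s ^ j * Real.exp (-u * s) * ρ s := fun ε hε j u => hset _ hε
  have hmass : ∀ ε : ℝ, 0 ≤ ε → ((levyMeasure ρ κ).restrict (Ioi ε)).real univ
      = κ * ∫ s in Ioi ε, ρ s := fun ε hε => by
    simpa using hset (fun _ => 1) hε
  have hexponent : ∀ u, -laplaceExponent (levyMeasure ρ κ) u
      = κ * ∫ s in Ioi (0 : ℝ), (Real.exp (-u * s) - 1) * ρ s := fun u => by
    rw [← hset _ le_rfl, restrict_levyMeasure_Ioi_zero, laplaceExponent, ← integral_neg]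
    simp
  have h := tendsto_integral_eppf_restrict (ν := levyMeasure ρ κ) ae_levyMeasure_pos
    (integrable_min_levyMeasure hρmeas hκ hreg1) (levyMeasure_univ hκ hreg2) hk nv hnv hΓ
  have hlimit : ∀ j u, tiltedMoment (levyMeasure ρ κ) j u
      = κ * ∫ s in Ioi (0 : ℝ), s ^ j * Real.exp (-u * s) * ρ s := fun j u => by
    rw [← hmoment 0 le_rfl, restrict_levyMeasure_Ioi_zero]
  simp only [hexponent, hlimit] at h
  refine h.congr' ?_
  filter_upwards [self_mem_nhdsWithin] with ε hε
  simp only [hmoment ε (mem_Ioi.1 hε).le, hmass ε (mem_Ioi.1 hε).le, pow_zero, one_mul]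
end

section
/- Let ρ: (0,∞)→[0,∞) be measurable with ∫_0^∞ min(1,s) ρ(s) ds < ∞ and ∫_0^∞ ρ(s) ds = +∞, and let κ > 0. For each set partition C = {C_1,…,C_k} of {1,…,n} with block sizes n_1,…,n_k, let p_0(C) = ∫_0^∞ [ (u^{n−1}/Γ(n)) · exp( κ ∫_0^∞ (e^{−u s} − 1) ρ(s) ds ) · ∏_{i=1}^k κ ∫_0^∞ s^{n_i} e^{−u s} ρ(s) ds ] du. Then for every integer n ≥ 1, the sum of p_0(C) over all set partitions C of {1,…,n} equals 1. -/
open MeasureTheory Filter Topology Set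

/-- The sum over all set partitions of `s` of the product of the block weights `m |t|`. -/
noncomputable def partitionSum {α : Type*} [DecidableEq α] (m : ℕ → ℝ) (s : Finset α) : ℝ :=
  ∑ C : Finpartition s, ∏ t ∈ C.parts, m t.card

lemma partitionSum_empty {α : Type*} [DecidableEq α] (m : ℕ → ℝ) :
    partitionSum m (∅ : Finset α) = 1 := by
  have h : ∀ C : Finpartition (∅ : Finset α), ∏ t ∈ C.parts, m t.card = 1 := by
    intro C
    rw [C.parts_eq_empty_iff.2 rfl, Finset.prod_empty]
  have : Unique (Finpartition (∅ : Finset α)) :=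
    inferInstanceAs (Unique (Finpartition (⊥ : Finset α)))
  rw [partitionSum, Fintype.sum_congr _ _ h]
  simp

/-- Conditioning on the block of `a`, which is `insert a t` for some `t ⊆ s`. -/
lemma partitionSum_insert {α : Type*} [DecidableEq α] (m : ℕ → ℝ) {a : α} {s : Finset α}
    (ha : a ∉ s) :
    partitionSum m (insert a s) =
      ∑ t ∈ s.powerset, m (t.card + 1) * partitionSum m (s \ t) := by
  have hat : ∀ t ∈ s.powerset, a ∉ t := fun t ht h => ha (Finset.mem_powerset.1 ht h)
  let e : (Σ t : s.powerset, Finpartition (s \ t.1)) → Finpartition (insert a s) := fun x =>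
    x.2.extend (b := insert a x.1.1) (Finset.insert_ne_empty _ _)
      (by
        rw [Finset.disjoint_insert_right]
        exact ⟨fun h => ha (Finset.mem_sdiff.1 h).1, Finset.sdiff_disjoint⟩)
      (by
        rw [Finset.sup_eq_union, Finset.union_insert,
          Finset.sdiff_union_of_subset (Finset.mem_powerset.1 x.1.2)])
  have hnot : ∀ (t : s.powerset) (Q : Finpartition (s \ t.1)) (b : Finset α),
      b ∈ Q.parts → a ∉ b := fun t Q b hb h => ha (Finset.mem_sdiff.1 (Q.subset hb h)).1
  have hparts : ∀ x, (e x).parts = insert (insert a x.1.1) x.2.parts := fun x => rfl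
  have hnm : ∀ x : (Σ t : s.powerset, Finpartition (s \ t.1)), insert a x.1.1 ∉ x.2.parts :=
    fun x h => hnot _ _ _ h (Finset.mem_insert_self _ _)
  have he : Function.Bijective e := by
    constructor
    · rintro ⟨t, Q⟩ ⟨t', Q'⟩ h
      have hp : insert (insert a t.1) Q.parts = insert (insert a t'.1) Q'.parts := by
        have := congrArg Finpartition.parts h
        simpa only [hparts] using this
      have h1 : insert a t.1 = insert a t'.1 := by
        have : insert a t.1 ∈ insert (insert a t'.1) Q'.parts :=
          hp ▸ Finset.mem_insert_self _ _
        rcases Finset.mem_insert.1 this with h | h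
        · exact h
        · exact absurd (Finset.mem_insert_self _ _) (hnot _ _ _ h)
      have h2 : t = t' := by
        apply Subtype.ext
        rw [← Finset.erase_insert (hat _ t.2), h1, Finset.erase_insert (hat _ t'.2)]
      subst h2
      have h3 : Q = Q' := by
        apply Finpartition.ext
        rw [← Finset.erase_insert (hnm ⟨t, Q⟩), ← Finset.erase_insert (hnm ⟨t, Q'⟩), hp]
      rw [h3]
    · intro P
      have hpa : P.part a ∈ P.parts := P.part_mem.2 (Finset.mem_insert_self _ _)
      have haa : a ∈ P.part a := P.mem_part_self.2 (Finset.mem_insert_self _ _)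
      have hsub : (P.part a).erase a ⊆ s := by
        intro x hx
        have := P.subset hpa (Finset.mem_of_mem_erase hx)
        exact (Finset.mem_insert.1 this).resolve_left (Finset.ne_of_mem_erase hx)
      let Q : Finpartition (s \ (P.part a).erase a) :=
        { parts := P.parts.erase (P.part a)
          supIndep := P.supIndep.subset (Finset.erase_subset _ _)
          sup_parts := by
            ext x
            simp only [Finset.mem_sup, Finset.mem_erase, id, Finset.mem_sdiff, not_and]
            constructor
            · rintro ⟨b, ⟨hb, hbP⟩, hx⟩
              have hxn : x ∉ P.part a := fun h => hb (P.eq_of_mem_parts hbP hpa hx h)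
              refine ⟨(Finset.mem_insert.1 (P.subset hbP hx)).resolve_left ?_, fun _ => hxn⟩
              rintro rfl
              exact hxn haa
            · rintro ⟨hx, hxn⟩
              have hxa : x ≠ a := by rintro rfl; exact ha hx
              obtain ⟨b, hb, hxb⟩ := P.exists_mem (Finset.mem_insert_of_mem (b := a) hx)
              refine ⟨b, ⟨?_, hb⟩, hxb⟩
              rintro rfl
              exact hxn hxa hxb
          bot_notMem := fun h => P.bot_notMem (Finset.mem_of_mem_erase h) }
      refine ⟨⟨⟨(P.part a).erase a, Finset.mem_powerset.2 hsub⟩, Q⟩, ?_⟩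
      apply Finpartition.ext
      rw [hparts]
      change insert (insert a ((P.part a).erase a)) (P.parts.erase (P.part a)) = P.parts
      rw [Finset.insert_erase haa, Finset.insert_erase hpa]
  rw [partitionSum, ← he.sum_comp, Fintype.sum_sigma, ← Finset.sum_coe_sort s.powerset]
  refine Finset.sum_congr rfl fun t _ => ?_
  rw [partitionSum, Finset.mul_sum]
  refine Finset.sum_congr rfl fun Q _ => ?_
  rw [hparts, Finset.prod_insert (hnm ⟨t, Q⟩), Finset.card_insert_of_notMem (hat _ t.2)]

lemma partitionSum_insert_insert {α : Type*} [DecidableEq α] (m : ℕ → ℝ) {a b : α}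
    {s : Finset α} (ha : a ∉ s) (hb : b ∉ insert a s) :
    partitionSum m (insert b (insert a s)) =
      ∑ t ∈ s.powerset, (m (t.card + 2) * partitionSum m (s \ t) +
        m (t.card + 1) * partitionSum m (insert b (s \ t))) := by
  have hbs : b ∉ s := fun h => hb (Finset.mem_insert_of_mem h)
  have hab : a ∉ insert b s := by
    rw [Finset.mem_insert, not_or]
    exact ⟨fun h => hb (h ▸ Finset.mem_insert_self _ _), ha⟩
  rw [Finset.insert_comm, partitionSum_insert m hab, Finset.sum_powerset_insert hbs, add_comm,
    ← Finset.sum_add_distrib]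
  refine Finset.sum_congr rfl fun t ht => ?_
  have hbt : b ∉ t := fun h => hbs (Finset.mem_powerset.1 ht h)
  rw [Finset.card_insert_of_notMem hbt, Finset.insert_sdiff_insert,
    Finset.insert_sdiff_of_notMem _ hbt, Finset.sdiff_insert_of_notMem hbs]

lemma hasDerivAt_mul_partitionSum {α : Type*} [DecidableEq α] {f : ℝ → ℝ} {m : ℕ → ℝ → ℝ} {u : ℝ}
    (hf : HasDerivAt f (-(m 1 u * f u)) u)
    (hm : ∀ k, HasDerivAt (m (k + 1)) (-m (k + 2) u) u) (s : Finset α) :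
    ∀ b ∉ s, HasDerivAt (fun v => f v * partitionSum (fun k => m k v) s)
      (-(f u * partitionSum (fun k => m k u) (insert b s))) u := by
  induction s using Finset.strongInduction with
  | H s ih =>
    intro b hb
    rcases s.eq_empty_or_nonempty with rfl | ⟨a, has⟩
    · simp only [partitionSum_empty, partitionSum_insert _ hb]
      simpa [partitionSum_empty, mul_comm] using hf
    · obtain ⟨s, ha, rfl⟩ : ∃ s', a ∉ s' ∧ insert a s' = s :=
        ⟨s.erase a, Finset.notMem_erase _ _, Finset.insert_erase has⟩
      simp only [partitionSum_insert _ ha, partitionSum_insert_insert _ ha hb, Finset.mul_sum,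
        ← Finset.sum_neg_distrib]
      refine HasDerivAt.fun_sum fun t ht => ?_
      have hlt : s \ t ⊂ insert a s :=
        lt_of_le_of_lt Finset.sdiff_subset (Finset.ssubset_insert ha)
      have hbt : b ∉ s \ t := fun h =>
        hb (Finset.mem_insert_of_mem (Finset.mem_sdiff.1 h).1)
      have h := (hm t.card).fun_mul (ih _ hlt b hbt)
      simp only [mul_left_comm _ (f _)] at h
      exact h.congr_deriv (by ring)

lemma partitionSum_nonneg {α : Type*} [DecidableEq α] {m : ℕ → ℝ} (hm : ∀ k, 0 ≤ m k)
    (s : Finset α) : 0 ≤ partitionSum m s :=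
  Finset.sum_nonneg fun _ _ => Finset.prod_nonneg fun _ _ => hm _

/-- Integration by parts against a power, for a nonnegative decreasing function: the boundary
terms vanish automatically. -/
lemma integral_pow_succ_mul_neg_deriv {F F' : ℝ → ℝ} (n : ℕ)
    (hd : ∀ u ∈ Ioi (0 : ℝ), HasDerivAt F (-F' u) u)
    (hF : ∀ u ∈ Ioi (0 : ℝ), 0 ≤ F u) (hF' : ∀ u ∈ Ioi (0 : ℝ), 0 ≤ F' u)
    (hint : IntegrableOn (fun u => u ^ n * F u) (Ioi 0)) :
    IntegrableOn (fun u => u ^ (n + 1) * F' u) (Ioi 0) ∧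
      ∫ u in Ioi (0 : ℝ), u ^ (n + 1) * F' u = (n + 1) * ∫ u in Ioi (0 : ℝ), u ^ n * F u := by
  have hcont : ContinuousOn F (Ioi 0) := fun u hu => (hd u hu).continuousAt.continuousWithinAt
  have hanti : AntitoneOn F (Ioi 0) := by
    refine antitoneOn_of_deriv_nonpos (convex_Ioi 0) hcont ?_ ?_
    · rw [interior_Ioi]
      exact fun u hu => (hd u hu).differentiableAt.differentiableWithinAt
    · rw [interior_Ioi]
      intro u hu
      rw [(hd u hu).deriv]
      exact neg_nonpos.2 (hF' u hu)
  set G : ℝ → ℝ := fun u => ∫ v in (0 : ℝ)..u, v ^ n * F v with hG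
  have hii : ∀ a b : ℝ, 0 ≤ a → 0 ≤ b →
      IntervalIntegrable (fun u => u ^ n * F u) volume a b := by
    intro a b ha hb
    rw [intervalIntegrable_iff]
    refine hint.mono_set fun x hx => lt_of_le_of_lt (le_min ha hb) hx.1
  have hG0 : G 0 = 0 := intervalIntegral.integral_same
  have hGc : ContinuousWithinAt G (Ici 0) 0 := by
    have h := intervalIntegral.continuousOn_primitive_interval' (hii 0 1 le_rfl zero_le_one)
      (left_mem_uIcc)
    rw [uIcc_of_le zero_le_one] at h
    have := h 0 ⟨le_rfl, zero_le_one⟩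
    exact this.mono_of_mem_nhdsWithin (Icc_mem_nhdsGE zero_lt_one)
  have hGt : Tendsto G atTop (𝓝 (∫ u in Ioi (0 : ℝ), u ^ n * F u)) :=
    intervalIntegral_tendsto_integral_Ioi 0 hint tendsto_id
  have hGd : ∀ u ∈ Ioi (0 : ℝ), HasDerivAt G (u ^ n * F u) u := by
    intro u hu
    have hc : ContinuousOn (fun u => u ^ n * F u) (Ioi 0) := (continuousOn_pow n).mul hcont
    exact intervalIntegral.integral_hasDerivAt_right (hii 0 u le_rfl (le_of_lt hu))
      (hc.stronglyMeasurableAtFilter isOpen_Ioi u hu)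
      (hc.continuousAt (isOpen_Ioi.mem_nhds hu))
  have hbd : ∀ u ∈ Ici (0 : ℝ), u ^ (n + 1) * F u ≤ 2 ^ (n + 1) * (G u - G (u / 2)) := by
    intro u hu
    rcases (mem_Ici.1 hu).eq_or_lt with rfl | hu
    · simp
    have hsub : G u - G (u / 2) = ∫ v in (u / 2)..u, v ^ n * F v :=
      intervalIntegral.integral_interval_sub_left (hii _ _ le_rfl hu.le)
        (hii _ _ le_rfl (by positivity))
    have hle : ∫ v in (u / 2)..u, (u / 2) ^ n * F u ≤ ∫ v in (u / 2)..u, v ^ n * F v := by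
      refine intervalIntegral.integral_mono_on (by linarith) (by simp)
        (hii _ _ (by positivity) hu.le) fun v hv => ?_
      have hv0 : 0 < v := lt_of_lt_of_le (half_pos hu) hv.1
      exact mul_le_mul (pow_le_pow_left₀ (half_pos hu).le hv.1 n) (hanti hv0 hu hv.2)
        (hF u hu) (by positivity)
    rw [intervalIntegral.integral_const, smul_eq_mul] at hle
    rw [hsub]
    calc u ^ (n + 1) * F u = 2 ^ (n + 1) * ((u - u / 2) * ((u / 2) ^ n * F u)) := by
          rw [div_pow]; field_simp; ring
      _ ≤ _ := by gcongr
  have hnn : ∀ u ∈ Ici (0 : ℝ), 0 ≤ u ^ (n + 1) * F u := by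
    intro u hu
    rcases (mem_Ici.1 hu).eq_or_lt with rfl | hu
    · simp
    · exact mul_nonneg (by positivity) (hF u hu)
  have h0 : Tendsto (fun u => u ^ (n + 1) * F u) (𝓝[≥] 0) (𝓝 0) := by
    have hh : Tendsto (fun u : ℝ => u / 2) (𝓝[≥] 0) (𝓝[≥] 0) := by
      refine tendsto_nhdsWithin_of_tendsto_nhds_of_eventually_within _ ?_ ?_
      · have : Tendsto (fun u : ℝ => u / 2) (𝓝 0) (𝓝 (0 / 2)) := tendsto_id.div_const 2
        rw [zero_div] at this
        exact this.mono_left nhdsWithin_le_nhds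
      · filter_upwards [self_mem_nhdsWithin] with u hu
        exact div_nonneg (mem_Ici.1 hu) two_pos.le
    have h1 : Tendsto (fun u => 2 ^ (n + 1) * (G u - G (u / 2))) (𝓝[≥] 0) (𝓝 0) := by
      have := (hGc.tendsto.sub (hGc.tendsto.comp hh)).const_mul ((2 : ℝ) ^ (n + 1))
      simpa using this
    refine tendsto_of_tendsto_of_tendsto_of_le_of_le' tendsto_const_nhds h1 ?_ ?_
    · filter_upwards [self_mem_nhdsWithin] with u hu using hnn u hu
    · filter_upwards [self_mem_nhdsWithin] with u hu using hbd u hu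
  have hinf : Tendsto (fun u => u ^ (n + 1) * F u) atTop (𝓝 0) := by
    have hh : Tendsto (fun u : ℝ => u / 2) atTop atTop := tendsto_id.atTop_div_const zero_lt_two
    have h1 : Tendsto (fun u => 2 ^ (n + 1) * (G u - G (u / 2))) atTop (𝓝 0) := by
      have := (hGt.sub (hGt.comp hh)).const_mul ((2 : ℝ) ^ (n + 1))
      simpa using this
    refine tendsto_of_tendsto_of_tendsto_of_le_of_le' tendsto_const_nhds h1 ?_ ?_
    · filter_upwards [eventually_ge_atTop 0] with u hu using hnn u hu
    · filter_upwards [eventually_ge_atTop 0] with u hu using hbd u hu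
  set H : ℝ → ℝ := fun u => u ^ (n + 1) * F u - (n + 1) * G u with hH
  have hH0 : H 0 = 0 := by simp [hH, hG0]
  have hHc : ContinuousWithinAt H (Ici 0) 0 := by
    have := h0.sub (hGc.tendsto.const_mul ((n : ℝ) + 1))
    rw [hG0] at this
    rw [ContinuousWithinAt, hH0]
    simpa using this
  have hHd : ∀ u ∈ Ioi (0 : ℝ), HasDerivAt H (-(u ^ (n + 1) * F' u)) u := by
    intro u hu
    refine (((hasDerivAt_pow (n + 1) u).fun_mul (hd u hu)).fun_sub
      ((hGd u hu).const_mul ((n : ℝ) + 1))).congr_deriv ?_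
    rw [Nat.add_sub_cancel]
    push_cast
    ring
  have hHt : Tendsto H atTop (𝓝 (0 - (n + 1) * ∫ u in Ioi (0 : ℝ), u ^ n * F u)) :=
    hinf.sub (hGt.const_mul _)
  have hneg : ∀ u ∈ Ioi (0 : ℝ), -(u ^ (n + 1) * F' u) ≤ 0 := fun u hu =>
    neg_nonpos.2 (mul_nonneg (pow_nonneg (le_of_lt hu) _) (hF' u hu))
  refine ⟨?_, ?_⟩
  · simpa using (integrableOn_Ioi_deriv_of_nonpos hHc hHd hneg hHt).neg
  · have := integral_Ioi_of_hasDerivAt_of_nonpos hHc hHd hneg hHt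
    rw [integral_neg, hH0] at this
    linarith

lemma pow_succ_mul_exp_neg_le {c : ℝ} (hc : 0 < c) (k : ℕ) :
    ∃ B : ℝ, ∀ s : ℝ, 0 < s → s ^ (k + 1) * Real.exp (-c * s) ≤ B * min 1 s := by
  have key : ∀ j : ℕ, ∀ s : ℝ, 0 < s → s ^ j * Real.exp (-c * s) ≤ j.factorial / c ^ j := by
    intro j s hs
    have h := Real.pow_div_factorial_le_exp (c * s) (by positivity) j
    rw [div_le_iff₀ (by positivity), mul_pow] at h
    rw [neg_mul, Real.exp_neg, le_div_iff₀ (by positivity), ← div_eq_mul_inv, div_mul_eq_mul_div,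
      div_le_iff₀ (Real.exp_pos _)]
    linarith
  refine ⟨(k + 1).factorial / c ^ (k + 1) + k.factorial / c ^ k, fun s hs => ?_⟩
  have h1 := key (k + 1) s hs
  have h2 := mul_le_mul_of_nonneg_right (key k s hs) hs.le
  have hA : 0 ≤ ((k + 1).factorial / c ^ (k + 1) : ℝ) := by positivity
  have hB : 0 ≤ (k.factorial / c ^ k : ℝ) := by positivity
  rcases le_total 1 s with h | h
  · rw [min_eq_left h]; linarith
  · rw [min_eq_right h, pow_succ]
    nlinarith [mul_nonneg hA hs.le]

lemma abs_exp_neg_mul_sub_one_le {u s : ℝ} (hu : 0 ≤ u) (hs : 0 < s) :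
    |Real.exp (-u * s) - 1| ≤ max 1 u * min 1 s := by
  have h1 : Real.exp (-u * s) ≤ 1 := Real.exp_le_one_iff.2 (by nlinarith)
  have h2 := Real.add_one_le_exp (-u * s)
  have h3 := Real.exp_pos (-u * s)
  rw [abs_of_nonpos (by linarith)]
  have h4 : 1 ≤ max 1 u := le_max_left _ _
  have h5 : u ≤ max 1 u := le_max_right _ _
  rcases le_total 1 s with h | h
  · rw [min_eq_left h]; linarith
  · rw [min_eq_right h]; nlinarith

/-- The bound on `ρ` near `0` and at infinity that makes `ρ` a Lévy density on `(0, ∞)`. -/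
structure IsLevyDensity (ρ : ℝ → ℝ) : Prop where
  measurable : Measurable ρ
  nonneg : ∀ s ∈ Ioi (0 : ℝ), 0 ≤ ρ s
  integrableOn : IntegrableOn (fun s => min 1 s * ρ s) (Ioi 0)

namespace IsLevyDensity

lemma integrableOn_of_le {ρ : ℝ → ℝ} (hρ : IsLevyDensity ρ) {g : ℝ → ℝ} (hg : Measurable g)
    {B : ℝ} (hB : ∀ s ∈ Ioi (0 : ℝ), |g s| ≤ B * min 1 s) :
    IntegrableOn (fun s => g s * ρ s) (Ioi 0) := by
  refine (hρ.integrableOn.const_mul B).mono' (hg.mul hρ.measurable).aestronglyMeasurable ?_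
  filter_upwards [ae_restrict_mem measurableSet_Ioi] with s hs
  rw [Real.norm_eq_abs, abs_mul, abs_of_nonneg (hρ.nonneg s hs), ← mul_assoc]
  exact mul_le_mul_of_nonneg_right (hB s hs) (hρ.nonneg s hs)

lemma integrableOn_exp_sub_one {ρ : ℝ → ℝ} (hρ : IsLevyDensity ρ) {u : ℝ} (hu : 0 ≤ u) :
    IntegrableOn (fun s => (Real.exp (-u * s) - 1) * ρ s) (Ioi 0) :=
  hρ.integrableOn_of_le (by fun_prop) fun _ hs => abs_exp_neg_mul_sub_one_le hu hs

lemma integrableOn_pow_mul_exp {ρ : ℝ → ℝ} (hρ : IsLevyDensity ρ) (k : ℕ) {u : ℝ} (hu : 0 < u) :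
    IntegrableOn (fun s => s ^ (k + 1) * Real.exp (-u * s) * ρ s) (Ioi 0) := by
  obtain ⟨B, hB⟩ := pow_succ_mul_exp_neg_le hu k
  refine hρ.integrableOn_of_le (by fun_prop) (B := B) fun s hs => ?_
  have : (0 : ℝ) < s := hs
  rw [abs_of_nonneg (by positivity)]
  exact hB s hs

/-- Differentiation under the integral sign, for integrands whose derivative in `u` is
`-s ^ (k + 1) * exp (-u * s)`. -/
lemma hasDerivAt_integral {ρ : ℝ → ℝ} (hρ : IsLevyDensity ρ) (k : ℕ) {u : ℝ} (hu : 0 < u)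
    {g : ℝ → ℝ → ℝ} (hg : ∀ v, Measurable (g v))
    (hgi : IntegrableOn (fun s => g u s * ρ s) (Ioi 0))
    (hgd : ∀ v s, HasDerivAt (fun v => g v s) (-(s ^ (k + 1) * Real.exp (-v * s))) v) :
    HasDerivAt (fun v => ∫ s in Ioi (0 : ℝ), g v s * ρ s)
      (-∫ s in Ioi (0 : ℝ), s ^ (k + 1) * Real.exp (-u * s) * ρ s) u := by
  rw [← integral_neg]
  obtain ⟨B, hB⟩ := pow_succ_mul_exp_neg_le (half_pos hu) k
  refine (hasDerivAt_integral_of_dominated_loc_of_deriv_le (μ := volume.restrict (Ioi 0))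
    (F := fun v s => g v s * ρ s)
    (F' := fun v s => -(s ^ (k + 1) * Real.exp (-v * s) * ρ s))
    (bound := fun s => B * (min 1 s * ρ s)) (s := Ioi (u / 2))
    (Ioi_mem_nhds (half_lt_self hu)) ?_ hgi ?_ ?_ (hρ.integrableOn.const_mul B) ?_).2
  · exact Eventually.of_forall fun v => ((hg v).mul hρ.measurable).aestronglyMeasurable
  · have := hρ.measurable
    exact Measurable.aestronglyMeasurable (by fun_prop)
  · filter_upwards [ae_restrict_mem measurableSet_Ioi] with s hs v hv
    have hs' : (0 : ℝ) < s := hs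
    have hv' : u / 2 < v := hv
    have hρs := hρ.nonneg s hs
    rw [norm_neg, Real.norm_eq_abs, abs_of_nonneg (by positivity), ← mul_assoc]
    refine mul_le_mul_of_nonneg_right (le_trans ?_ (hB s hs)) hρs
    gcongr
  · refine Eventually.of_forall fun s v _ => ?_
    have := (hgd v s).mul_const (ρ s)
    rwa [neg_mul] at this

lemma hasDerivAt_laplaceExponent {ρ : ℝ → ℝ} (hρ : IsLevyDensity ρ) {u : ℝ} (hu : 0 < u) :
    HasDerivAt (fun v => ∫ s in Ioi (0 : ℝ), (Real.exp (-v * s) - 1) * ρ s)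
      (-∫ s in Ioi (0 : ℝ), s ^ 1 * Real.exp (-u * s) * ρ s) u := by
  refine hρ.hasDerivAt_integral 0 hu (fun v => by fun_prop)
    (hρ.integrableOn_exp_sub_one hu.le) fun v s => ?_
  exact ((((hasDerivAt_id' v).fun_neg).mul_const s).exp.sub_const 1).congr_deriv (by ring)

lemma hasDerivAt_moment {ρ : ℝ → ℝ} (hρ : IsLevyDensity ρ) (k : ℕ) {u : ℝ} (hu : 0 < u) :
    HasDerivAt (fun v => ∫ s in Ioi (0 : ℝ), s ^ (k + 1) * Real.exp (-v * s) * ρ s)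
      (-∫ s in Ioi (0 : ℝ), s ^ (k + 2) * Real.exp (-u * s) * ρ s) u := by
  refine hρ.hasDerivAt_integral (k + 1) hu (fun v => by fun_prop)
    (hρ.integrableOn_pow_mul_exp k hu) fun v s => ?_
  exact ((((hasDerivAt_id' v).fun_neg).mul_const s).exp.const_mul
    (s ^ (k + 1))).congr_deriv (by ring)

lemma continuousWithinAt_laplaceExponent {ρ : ℝ → ℝ} (hρ : IsLevyDensity ρ) :
    ContinuousWithinAt (fun v => ∫ s in Ioi (0 : ℝ), (Real.exp (-v * s) - 1) * ρ s)
      (Ici 0) 0 := by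
  have := hρ.measurable
  refine continuousWithinAt_of_dominated (bound := fun s => min 1 s * ρ s) ?_ ?_
    hρ.integrableOn ?_
  · exact Eventually.of_forall fun v => Measurable.aestronglyMeasurable (by fun_prop)
  · filter_upwards [Icc_mem_nhdsGE (zero_lt_one' ℝ)] with v hv
    filter_upwards [ae_restrict_mem measurableSet_Ioi] with s hs
    rw [Real.norm_eq_abs, abs_mul, abs_of_nonneg (hρ.nonneg s hs)]
    refine mul_le_mul_of_nonneg_right ?_ (hρ.nonneg s hs)
    simpa [max_eq_left hv.2] using abs_exp_neg_mul_sub_one_le hv.1 hs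
  · refine Eventually.of_forall fun s => Continuous.continuousWithinAt ?_
    fun_prop

lemma tendsto_laplaceExponent {ρ : ℝ → ℝ} (hρ : IsLevyDensity ρ)
    (hinf : ∫⁻ s in Ioi (0 : ℝ), ENNReal.ofReal (ρ s) = ⊤) :
    Tendsto (fun v => ∫ s in Ioi (0 : ℝ), (Real.exp (-v * s) - 1) * ρ s) atTop atBot := by
  have hm := hρ.measurable
  have hlim : Tendsto (fun n : ℕ => ∫⁻ s in Ioi (0 : ℝ),
      ENNReal.ofReal ((1 - Real.exp (-(n : ℝ) * s)) * ρ s)) atTop (𝓝 ⊤) := by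
    rw [← hinf]
    refine lintegral_tendsto_of_tendsto_of_monotone
      (fun n => Measurable.aemeasurable (by fun_prop)) ?_ ?_
    · filter_upwards [ae_restrict_mem measurableSet_Ioi] with s hs i j hij
      have hs' : (0 : ℝ) < s := hs
      have hρs := hρ.nonneg s hs
      dsimp only
      gcongr
    · filter_upwards [ae_restrict_mem measurableSet_Ioi] with s hs
      have hs' : (0 : ℝ) < s := hs
      refine ENNReal.tendsto_ofReal ?_
      have h1 : Tendsto (fun n : ℕ => Real.exp (-(n : ℝ) * s)) atTop (𝓝 0) := by
        refine Real.tendsto_exp_atBot.comp ?_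
        simp only [neg_mul]
        exact tendsto_neg_atTop_atBot.comp (tendsto_natCast_atTop_atTop.atTop_mul_const hs')
      simpa using (h1.const_sub 1).mul_const (ρ s)
  rw [tendsto_atBot]
  intro b
  obtain ⟨n, hn⟩ := (hlim.eventually (lt_mem_nhds (ENNReal.ofReal_lt_top (r := -b)))).exists
  filter_upwards [eventually_ge_atTop (n : ℝ)] with v hv
  have hn0 : (0 : ℝ) ≤ n := n.cast_nonneg
  have hnn : 0 ≤ᵐ[volume.restrict (Ioi (0 : ℝ))]
      fun s => (1 - Real.exp (-(n : ℝ) * s)) * ρ s := by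
    filter_upwards [ae_restrict_mem measurableSet_Ioi] with s hs
    have hs' : (0 : ℝ) < s := hs
    refine mul_nonneg (sub_nonneg.2 (Real.exp_le_one_iff.2 ?_)) (hρ.nonneg s hs)
    nlinarith
  have hneg : ∫ s in Ioi (0 : ℝ), (1 - Real.exp (-(n : ℝ) * s)) * ρ s =
      -∫ s in Ioi (0 : ℝ), (Real.exp (-(n : ℝ) * s) - 1) * ρ s := by
    rw [← integral_neg]
    congr 1
    ext s
    ring
  have hint : IntegrableOn (fun s => (1 - Real.exp (-(n : ℝ) * s)) * ρ s) (Ioi 0) := by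
    refine (hρ.integrableOn_exp_sub_one hn0).neg.congr (Eventually.of_forall fun s => ?_)
    simp only [Pi.neg_apply]
    ring
  rw [← ofReal_integral_eq_lintegral_ofReal hint hnn, hneg,
    ENNReal.ofReal_lt_ofReal_iff'] at hn
  have hle : ∫ s in Ioi (0 : ℝ), (Real.exp (-v * s) - 1) * ρ s ≤
      ∫ s in Ioi (0 : ℝ), (Real.exp (-(n : ℝ) * s) - 1) * ρ s := by
    refine setIntegral_mono_on (hρ.integrableOn_exp_sub_one (hn0.trans hv))
      (hρ.integrableOn_exp_sub_one hn0) measurableSet_Ioi fun s hs => ?_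
    have hs' : (0 : ℝ) < s := hs
    have hρs := hρ.nonneg s hs
    gcongr
  linarith [hn.1]

end IsLevyDensity

/-- If `f` has derivative `-m 1 * f` and `m k` has derivative `-m (k + 1)`, then `f * partitionSum`
is, up to sign, an iterated derivative of `f`; its moment of the matching order only depends on
`f 0`. -/
lemma integral_pow_mul_partitionSum {α : Type*} [DecidableEq α] {f : ℝ → ℝ} {m : ℕ → ℝ → ℝ}
    (hm0 : ∀ k u, 0 ≤ m k u) (hf0 : ∀ u, 0 ≤ f u)
    (hm : ∀ u ∈ Ioi (0 : ℝ), ∀ k, HasDerivAt (m (k + 1)) (-m (k + 2) u) u)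
    (hf : ∀ u ∈ Ioi (0 : ℝ), HasDerivAt f (-(m 1 u * f u)) u)
    (hftop : Tendsto f atTop (𝓝 0)) (hfc : ContinuousWithinAt f (Ici 0) 0)
    (s : Finset α) (hs : s.Nonempty) :
    IntegrableOn (fun u => u ^ (s.card - 1) * (f u * partitionSum (fun k => m k u) s)) (Ioi 0) ∧
      ∫ u in Ioi (0 : ℝ), u ^ (s.card - 1) * (f u * partitionSum (fun k => m k u) s) =
        (s.card - 1).factorial * f 0 := by
  have hF0 : ∀ (s : Finset α) (u : ℝ), 0 ≤ f u * partitionSum (fun k => m k u) s := fun s u =>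
    mul_nonneg (hf0 u) (partitionSum_nonneg (fun k => hm0 k u) s)
  have hFd := fun u hu => hasDerivAt_mul_partitionSum (α := α) (hf u hu) (hm u hu)
  induction s using Finset.induction_on with
  | empty => exact absurd hs Finset.not_nonempty_empty
  | insert b s hb ih =>
    rcases s.eq_empty_or_nonempty with rfl | hs'
    · have hd : ∀ u ∈ Ioi (0 : ℝ), HasDerivAt f
          (-(f u * partitionSum (fun k => m k u) (insert b (∅ : Finset α)))) u := by
        intro u hu
        simpa [partitionSum_empty] using hFd u hu ∅ b hb
      have hneg : ∀ u ∈ Ioi (0 : ℝ),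
          -(f u * partitionSum (fun k => m k u) (insert b (∅ : Finset α))) ≤ 0 :=
        fun u _ => neg_nonpos.2 (hF0 _ u)
      have h1 := integrableOn_Ioi_deriv_of_nonpos hfc hd hneg hftop
      have h2 := integral_Ioi_of_hasDerivAt_of_nonpos hfc hd hneg hftop
      rw [integral_neg] at h2
      rw [Finset.card_insert_of_notMem hb, Finset.card_empty]
      simp only [zero_add, Nat.sub_self, pow_zero, one_mul, Nat.factorial_zero, Nat.cast_one]
      exact ⟨by simpa using h1.neg, by linarith⟩
    · obtain ⟨h1, h2⟩ := ih hs'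
      obtain ⟨k, hk⟩ := Nat.exists_eq_succ_of_ne_zero (Finset.card_ne_zero.2 hs')
      rw [Finset.card_insert_of_notMem hb]
      simp only [hk, Nat.succ_eq_add_one, Nat.add_sub_cancel] at h1 h2 ⊢
      obtain ⟨h3, h4⟩ := integral_pow_succ_mul_neg_deriv k (fun u hu => hFd u hu s b hb)
        (fun u _ => hF0 s u) (fun u _ => hF0 _ u) h1
      refine ⟨h3, ?_⟩
      rw [h4, h2, Nat.factorial_succ]
      push_cast
      ring

/-- The eppf `p_0` of the homogeneous normalized completely random measure
sums to 1 over all set partitions of `{1, …, n}`: here a set partition of `{1,…,n}` is a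
`Finpartition` of `Finset.univ : Finset (Fin n)`, and the product runs over its blocks,
each contributing according to its size. -/
theorem eppf_normCRM_sums_to_one
    (ρ : ℝ → ℝ) (hρmeas : Measurable ρ) (hρnn : ∀ s ∈ Set.Ioi (0:ℝ), 0 ≤ ρ s)
    (hreg1 : ∫⁻ s in Set.Ioi (0:ℝ), ENNReal.ofReal (min 1 s * ρ s) < ⊤)
    (hreg2 : ∫⁻ s in Set.Ioi (0:ℝ), ENNReal.ofReal (ρ s) = ⊤)
    (κ : ℝ) (hκ : 0 < κ) :
    ∀ n : ℕ, 1 ≤ n →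
      ∑ C : Finpartition (Finset.univ : Finset (Fin n)),
        ∫ u in Set.Ioi (0:ℝ),
          (u ^ (n - 1) / Real.Gamma n) *
            Real.exp (κ * ∫ s in Set.Ioi (0:ℝ), (Real.exp (-u * s) - 1) * ρ s) *
            ∏ t ∈ C.parts, κ * ∫ s in Set.Ioi (0:ℝ), s ^ t.card * Real.exp (-u * s) * ρ s
        = 1 := by
  have hρ : IsLevyDensity ρ := by
    refine ⟨hρmeas, hρnn, Measurable.aestronglyMeasurable (by fun_prop), ?_⟩
    rw [hasFiniteIntegral_iff_ofReal]
    · exact hreg1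
    · filter_upwards [ae_restrict_mem measurableSet_Ioi] with s hs
      exact mul_nonneg (le_min zero_le_one (le_of_lt hs)) (hρnn s hs)
  intro n hn
  set f : ℝ → ℝ := fun u =>
    Real.exp (κ * ∫ s in Ioi (0 : ℝ), (Real.exp (-u * s) - 1) * ρ s) with hf
  set m : ℕ → ℝ → ℝ := fun k u =>
    κ * ∫ s in Ioi (0 : ℝ), s ^ k * Real.exp (-u * s) * ρ s with hm
  have hm0 : ∀ k u, 0 ≤ m k u := fun k u =>
    mul_nonneg hκ.le <| setIntegral_nonneg measurableSet_Ioi fun s hs =>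
      mul_nonneg (mul_nonneg (pow_nonneg (le_of_lt hs) _) (Real.exp_pos _).le) (hρnn s hs)
  have hmd : ∀ u ∈ Ioi (0 : ℝ), ∀ k, HasDerivAt (m (k + 1)) (-m (k + 2) u) u := by
    intro u hu k
    have := (hρ.hasDerivAt_moment k hu).const_mul κ
    rwa [mul_neg] at this
  have hfd : ∀ u ∈ Ioi (0 : ℝ), HasDerivAt f (-(m 1 u * f u)) u := by
    intro u hu
    refine ((hρ.hasDerivAt_laplaceExponent hu).const_mul κ).exp.congr_deriv ?_
    simp only [hm, hf]
    ring
  have hftop : Tendsto f atTop (𝓝 0) :=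
    Real.tendsto_exp_atBot.comp ((hρ.tendsto_laplaceExponent hreg2).const_mul_atBot hκ)
  have hfc : ContinuousWithinAt f (Ici 0) 0 :=
    (hρ.continuousWithinAt_laplaceExponent.const_mul κ).rexp
  have hf0 : f 0 = 1 := by simp [hf]
  have hterm0 : ∀ C : Finpartition (Finset.univ : Finset (Fin n)), ∀ u ∈ Ioi (0 : ℝ),
      0 ≤ u ^ (n - 1) / Real.Gamma n * f u * ∏ t ∈ C.parts, m t.card u := fun C u hu =>
    mul_nonneg (mul_nonneg (div_nonneg (pow_nonneg (le_of_lt hu) _)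
      (Real.Gamma_nonneg_of_nonneg n.cast_nonneg)) (Real.exp_pos _).le)
      (Finset.prod_nonneg fun _ _ => hm0 _ _)
  have hsum : ∀ u, ∑ C : Finpartition (Finset.univ : Finset (Fin n)),
      u ^ (n - 1) / Real.Gamma n * f u * ∏ t ∈ C.parts, m t.card u =
      (Real.Gamma n)⁻¹ * (u ^ (n - 1) *
        (f u * partitionSum (fun k => m k u) (Finset.univ : Finset (Fin n)))) := by
    intro u
    rw [← Finset.mul_sum, partitionSum]
    ring
  have := integral_pow_mul_partitionSum (f := f) hm0 (fun u => (Real.exp_pos _).le) hmd hfd hftop hfc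
    (Finset.univ : Finset (Fin n)) (Finset.univ_nonempty_iff.2 ⟨⟨0, hn⟩⟩)
  rw [Finset.card_fin, hf0, mul_one] at this
  obtain ⟨hint, hval⟩ := this
  have hintC : ∀ C : Finpartition (Finset.univ : Finset (Fin n)), IntegrableOn
      (fun u => u ^ (n - 1) / Real.Gamma n * f u * ∏ t ∈ C.parts, m t.card u) (Ioi 0) := by
    intro C
    refine (hint.const_mul (Real.Gamma n)⁻¹).mono' ?_ ?_
    · refine ContinuousOn.aestronglyMeasurable ?_ measurableSet_Ioi
      refine ContinuousOn.mul (ContinuousOn.mul (by fun_prop) fun u hu =>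
        (hfd u hu).continuousAt.continuousWithinAt) ?_
      refine continuousOn_finsetProd _ fun t ht u hu => ?_
      obtain ⟨k, hk⟩ := Nat.exists_eq_succ_of_ne_zero
        (Finset.card_ne_zero.2 (C.nonempty_of_mem_parts ht))
      rw [hk]
      exact (hmd u hu k).continuousAt.continuousWithinAt
    · filter_upwards [ae_restrict_mem measurableSet_Ioi] with u hu
      rw [Real.norm_eq_abs, abs_of_nonneg (hterm0 C u hu), ← hsum]
      exact Finset.single_le_sum (fun C _ => hterm0 C u hu) (Finset.mem_univ C)
  rw [← integral_finsetSum _ fun C _ => hintC C]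
  simp only [hsum]
  rw [integral_const_mul, hval]
  obtain ⟨k, rfl⟩ := Nat.exists_eq_add_of_le' hn
  rw [Nat.cast_add_one, Real.Gamma_nat_eq_factorial, Nat.add_sub_cancel]
  exact inv_mul_cancel₀ (by positivity)
end

section
/- For every real x ≥ 1, the series Σ_{m=1}^∞ Γ(2m) / (2^{2m} (m!)^2 x^{2m}) converges and equals −log( 1/2 + (1/2)√(1 − 1/x^2) ). Equivalently, writing Γ(2m)/(2^{2m}(m!)^2) = binom(2m,m)/(2m·4^m), for every z with 0 < z ≤ 1/4 one has Σ_{m=1}^∞ binom(2m,m) z^m/(2m) = log 2 − log(1 + √(1 − 4z)). -/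
open Set

theorem Ring.choose_neg_half_mul_neg_four_pow (n : ℕ) :
    Ring.choose (-(1 / 2) : ℝ) n * (-4) ^ n = Nat.centralBinom n := by
  induction n with
  | zero => simp
  | succ n ih =>
    have hrec : ((n : ℝ) + 1) * Ring.choose (-(1 / 2) : ℝ) (n + 1)
        = (-(1 / 2) - n) * Ring.choose (-(1 / 2) : ℝ) n := by
      have h0 : (n.factorial : ℝ) ≠ 0 := by positivity
      have h1 : (n : ℝ) + 1 ≠ 0 := by positivity
      rw [Ring.choose_eq_smul, Ring.choose_eq_smul, descPochhammer_succ_right,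
        Polynomial.smeval_mul, Nat.factorial_succ]
      simp [Polynomial.smeval_sub, Polynomial.smeval_X, Polynomial.smeval_natCast]
      field_simp
    have hcb : ((n : ℝ) + 1) * (Nat.centralBinom (n + 1) : ℝ)
        = 2 * (2 * n + 1) * Nat.centralBinom n := by
      exact_mod_cast Nat.succ_mul_centralBinom_succ n
    have h1 : (n : ℝ) + 1 ≠ 0 := by positivity
    apply mul_left_cancel₀ h1
    rw [hcb, ← ih, ← mul_assoc, hrec]
    ring

theorem hasSum_centralBinom_mul_pow {z : ℝ} (hz : |z| < 1 / 4) :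
    HasSum (fun n : ℕ => (Nat.centralBinom n : ℝ) * z ^ n) (1 / √(1 - 4 * z)) := by
  have hz' := abs_lt.mp hz
  have hmem : -4 * z ∈ Metric.eball (0 : ℝ) 1 := by
    rw [← ENNReal.ofReal_one, Metric.eball_ofReal, mem_ball_zero_iff, Real.norm_eq_abs, abs_mul]
    norm_num
    linarith
  have h := (Real.one_add_rpow_hasFPowerSeriesOnBall_zero (a := -(1 / 2))).hasSum hmem
  have hpos : 0 ≤ 1 - 4 * z := by linarith
  convert! h using 1
  · ext n
    simp only [binomialSeries_apply, List.ofFn_const, List.prod_replicate, smul_eq_mul]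
    rw [← Ring.choose_neg_half_mul_neg_four_pow, mul_pow, mul_assoc]
  · rw [Real.sqrt_eq_rpow, zero_add, Real.rpow_neg (by linarith), one_div]
    ring_nf

theorem hasSum_centralBinom_succ_mul_pow {z : ℝ} (hz : |z| < 1 / 4) :
    HasSum (fun n : ℕ => (Nat.centralBinom (n + 1) : ℝ) * z ^ n / 2)
      (2 / (√(1 - 4 * z) * (1 + √(1 - 4 * z)))) := by
  rcases eq_or_ne z 0 with rfl | hne
  · convert hasSum_single (0 : ℕ) ?_ using 1
    · norm_num [Nat.centralBinom, Nat.choose]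
    · intro n hn
      simp [hn]
  · have hz' := abs_lt.mp hz
    have hs : 0 < √(1 - 4 * z) := Real.sqrt_pos.mpr (by linarith)
    have hsq : √(1 - 4 * z) ^ 2 = 1 - 4 * z := Real.sq_sqrt (by linarith)
    have h := ((hasSum_nat_add_iff' 1).mpr (hasSum_centralBinom_mul_pow hz)).div_const (2 * z)
    convert! h using 1
    · ext n
      field_simp
      ring
    · simp only [Finset.range_one, Finset.sum_singleton, Nat.centralBinom_zero, pow_zero]
      field_simp
      push_cast
      linear_combination hsq

theorem hasDerivAt_log_one_add_sqrt {z : ℝ} (hz : z < 1 / 4) :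
    HasDerivAt (fun y : ℝ => Real.log 2 - Real.log (1 + √(1 - 4 * y)))
      (2 / (√(1 - 4 * z) * (1 + √(1 - 4 * z)))) z := by
  have hs : 0 < √(1 - 4 * z) := Real.sqrt_pos.mpr (by linarith)
  have h1 : HasDerivAt (fun y : ℝ => 1 - 4 * y) (-4) z := by
    simpa using ((hasDerivAt_id z).const_mul 4).const_sub 1
  have h2 := (((h1.sqrt (by linarith)).const_add 1).log (by positivity)).const_sub (Real.log 2)
  convert! h2 using 1
  field_simp
  norm_num

theorem hasSum_centralBinom_div_of_abs_lt {z : ℝ} (hz : |z| < 1 / 4) :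
    HasSum (fun n : ℕ => (Nat.centralBinom (n + 1) : ℝ) * z ^ (n + 1) / (2 * ((n : ℝ) + 1)))
      (Real.log 2 - Real.log (1 + √(1 - 4 * z))) := by
  obtain ⟨r, hzr, hr⟩ := exists_between hz
  have hr0 : 0 < r := (abs_nonneg z).trans_lt hzr
  set f : ℕ → ℝ → ℝ := fun n y =>
    (Nat.centralBinom (n + 1) : ℝ) * y ^ (n + 1) / (2 * ((n : ℝ) + 1)) with hf
  have hu : Summable fun n : ℕ => 2 * (4 * r) ^ n :=
    (summable_geometric_of_lt_one (by positivity) (by linarith)).mul_left 2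
  have hcb (n : ℕ) : (Nat.centralBinom (n + 1) : ℝ) ≤ 4 ^ (n + 1) := by
    exact_mod_cast Nat.centralBinom_le_four_pow (n + 1)
  have hderiv (n : ℕ) (y : ℝ) :
      HasDerivAt (f n) ((Nat.centralBinom (n + 1) : ℝ) * y ^ n / 2) y := by
    have h := ((hasDerivAt_pow (n + 1) y).const_mul (Nat.centralBinom (n + 1) : ℝ)).div_const
      (2 * ((n : ℝ) + 1))
    convert! h using 1
    have h1 : (n : ℝ) + 1 ≠ 0 := by positivity
    push_cast
    field_simp
  have hbound (n : ℕ) (y : ℝ) (hy : y ∈ Ioo (-r) r) :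
      ‖(Nat.centralBinom (n + 1) : ℝ) * y ^ n / 2‖ ≤ 2 * (4 * r) ^ n := by
    have hy' : |y| ≤ r := (abs_lt.mpr hy).le
    rw [norm_div, norm_mul, norm_pow, Real.norm_natCast, Real.norm_eq_abs, Real.norm_two]
    calc (Nat.centralBinom (n + 1) : ℝ) * |y| ^ n / 2 ≤ 4 ^ (n + 1) * r ^ n / 2 := by
          gcongr
          exact hcb n
      _ = 2 * (4 * r) ^ n := by rw [mul_pow]; ring
  have hzero : (0 : ℝ) ∈ Ioo (-r) r := ⟨by linarith, hr0⟩
  have hzmem : z ∈ Ioo (-r) r := abs_lt.mp hzr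
  have hsum0 : Summable fun n => f n 0 := by simp [hf]
  have hF (y : ℝ) (hy : y ∈ Ioo (-r) r) : HasDerivAt (fun w => ∑' n, f n w)
      (2 / (√(1 - 4 * y) * (1 + √(1 - 4 * y)))) y := by
    rw [← (hasSum_centralBinom_succ_mul_pow ((abs_lt.mpr hy).trans hr)).tsum_eq]
    exact hasDerivAt_tsum_of_isPreconnected hu isOpen_Ioo isPreconnected_Ioo
      (fun n w _ => hderiv n w) hbound hzero hsum0 hy
  have hG (y : ℝ) (hy : y ∈ Ioo (-r) r) := hasDerivAt_log_one_add_sqrt (hy.2.trans hr)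
  have heq : ∑' n, f n z = Real.log 2 - Real.log (1 + √(1 - 4 * z)) :=
    isOpen_Ioo.eqOn_of_deriv_eq isPreconnected_Ioo
      (fun y hy => (hF y hy).differentiableAt.differentiableWithinAt)
      (fun y hy => (hG y hy).differentiableAt.differentiableWithinAt)
      (fun y hy => (hF y hy).deriv.trans (hG y hy).deriv.symm) hzero
      (by norm_num [hf]) hzmem
  rw [← heq]
  exact (summable_of_summable_hasDerivAt_of_isPreconnected hu isOpen_Ioo isPreconnected_Ioo
    (fun n w _ => hderiv n w) hbound hzero hsum0 hzmem).hasSum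

theorem hasSum_centralBinom_div {z : ℝ} (hz0 : 0 ≤ z) (hz : z ≤ 1 / 4) :
    HasSum (fun n : ℕ => (Nat.centralBinom (n + 1) : ℝ) * z ^ (n + 1) / (2 * ((n : ℝ) + 1)))
      (Real.log 2 - Real.log (1 + √(1 - 4 * z))) := by
  set f : ℕ → ℝ → ℝ := fun n y =>
    (Nat.centralBinom (n + 1) : ℝ) * y ^ (n + 1) / (2 * ((n : ℝ) + 1)) with hf
  have hcont (n : ℕ) : Continuous (f n) := by fun_prop
  have hnonneg (n : ℕ) {y : ℝ} (hy : 0 ≤ y) : 0 ≤ f n y := by positivity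
  have hinterior {y : ℝ} (hy : y ∈ Ico (0 : ℝ) (1 / 4)) :
      HasSum (fun n => f n y) (Real.log 2 - Real.log (1 + √(1 - 4 * y))) :=
    hasSum_centralBinom_div_of_abs_lt (by rw [abs_of_nonneg hy.1]; exact hy.2)
  have hclosure : closure (Ico (0 : ℝ) (1 / 4)) = Icc 0 (1 / 4) := closure_Ico (by norm_num)
  have hquarter : (1 / 4 : ℝ) ∈ closure (Ico (0 : ℝ) (1 / 4)) := by
    rw [hclosure]; norm_num
  have hsummable : Summable fun n => f n (1 / 4) := by
    refine summable_of_sum_range_le (c := Real.log 2) (fun n => hnonneg n (by norm_num))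
      fun N => ?_
    refine closure_minimal (s := Ico (0 : ℝ) (1 / 4))
      (t := {y | ∑ i ∈ Finset.range N, f i y ≤ Real.log 2}) (fun y hy => ?_)
      (isClosed_le (by fun_prop) continuous_const) hquarter
    have h1 := sum_le_hasSum (Finset.range N) (fun n _ => hnonneg n hy.1) (hinterior hy)
    have h2 : 0 ≤ Real.log (1 + √(1 - 4 * y)) :=
      Real.log_nonneg (by linarith [Real.sqrt_nonneg (1 - 4 * y)])
    exact h1.trans (by linarith)
  have hle (n : ℕ) (y : ℝ) (hy : y ∈ Icc (0 : ℝ) (1 / 4)) : ‖f n y‖ ≤ f n (1 / 4) := by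
    have hy0 := hy.1
    rw [Real.norm_of_nonneg (hnonneg n hy.1)]
    simp only [hf]
    gcongr
    exact hy.2
  have hFcont : ContinuousOn (fun y => ∑' n, f n y) (Icc 0 (1 / 4)) :=
    continuousOn_tsum (fun n => (hcont n).continuousOn) hsummable hle
  have hGcont : ContinuousOn (fun y : ℝ => Real.log 2 - Real.log (1 + √(1 - 4 * y)))
      (Icc 0 (1 / 4)) := by
    have h0 (y : ℝ) : 1 + √(1 - 4 * y) ≠ 0 := by positivity
    exact (continuous_const.sub (Continuous.log (by fun_prop) h0)).continuousOn
  have heq : EqOn (fun y => ∑' n, f n y) (fun y => Real.log 2 - Real.log (1 + √(1 - 4 * y)))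
      (Icc 0 (1 / 4)) :=
    EqOn.of_subset_closure (fun y hy => (hinterior hy).tsum_eq) hFcont hGcont
      Ico_subset_Icc_self hclosure.ge
  have hmem : z ∈ Icc (0 : ℝ) (1 / 4) := ⟨hz0, hz⟩
  have hz_eq : ∑' n, f n z = Real.log 2 - Real.log (1 + √(1 - 4 * z)) := heq hmem
  rw [← hz_eq]
  exact (Summable.of_norm_bounded hsummable fun n => hle n z hmem).hasSum

theorem gamma_two_mul_div_eq_centralBinom (m : ℕ) (x : ℝ) :
    Real.Gamma (2 * ((m : ℝ) + 1)) /
        (2 ^ (2 * (m + 1)) * ((m + 1).factorial : ℝ) ^ 2 * x ^ (2 * (m + 1))) =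
      (Nat.centralBinom (m + 1) : ℝ) * (1 / (4 * x ^ 2)) ^ (m + 1) / (2 * ((m : ℝ) + 1)) := by
  have hG : Real.Gamma (2 * ((m : ℝ) + 1)) = ((2 * m + 1).factorial : ℝ) := by
    rw [← Real.Gamma_nat_eq_factorial]
    push_cast
    ring_nf
  have hcb : (Nat.centralBinom (m + 1) : ℝ) * ((m + 1).factorial : ℝ) ^ 2
      = (2 * ((m : ℝ) + 1)) * ((2 * m + 1).factorial : ℝ) := by
    have h := Nat.choose_mul_factorial_mul_factorial (n := 2 * (m + 1)) (k := m + 1) (by omega)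
    rw [show 2 * (m + 1) - (m + 1) = m + 1 by omega,
      show (2 * (m + 1)).factorial = (2 * m + 1 + 1) * (2 * m + 1).factorial from rfl,
      ← Nat.centralBinom_eq_two_mul_choose] at h
    have h' : (Nat.centralBinom (m + 1) : ℝ) * (m + 1).factorial * (m + 1).factorial
      = (2 * m + 1 + 1) * (2 * m + 1).factorial := by exact_mod_cast h
    linear_combination h'
  have h1 : ((m + 1).factorial : ℝ) ≠ 0 := by positivity
  have h2 : (m : ℝ) + 1 ≠ 0 := by positivity
  rw [hG, eq_div_of_mul_eq (pow_ne_zero 2 h1) hcb, pow_mul, pow_mul x, one_div, inv_pow, mul_pow]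
  norm_num
  field_simp

/-- For every real `x ≥ 1`, the series
`Σ_{m=1}^∞ Γ(2m) / (2^{2m} (m!)² x^{2m})` converges to `-log(1/2 + (1/2)√(1 - 1/x²))`;
equivalently, for `0 < z ≤ 1/4`,
`Σ_{m=1}^∞ binom(2m,m) z^m / (2m) = log 2 - log(1 + √(1 - 4z))`.
(The sums over `m ≥ 1` are expressed as sums over `m : ℕ` of the terms at `m + 1`.) -/
theorem bessel_jump_mass_series :
    (∀ x : ℝ, 1 ≤ x →
      HasSum
        (fun m : ℕ =>
          Real.Gamma (2 * ((m : ℝ) + 1)) /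
            (2 ^ (2 * (m + 1)) * ((Nat.factorial (m + 1) : ℝ)) ^ 2 * x ^ (2 * (m + 1))))
        (- Real.log (1 / 2 + (1 / 2) * Real.sqrt (1 - 1 / x ^ 2)))) ∧
    (∀ z : ℝ, 0 < z → z ≤ 1 / 4 →
      HasSum
        (fun m : ℕ =>
          (Nat.centralBinom (m + 1) : ℝ) * z ^ (m + 1) / (2 * ((m : ℝ) + 1)))
        (Real.log 2 - Real.log (1 + Real.sqrt (1 - 4 * z)))) := by
  refine ⟨fun x hx => ?_, fun z hz0 hz => hasSum_centralBinom_div hz0.le hz⟩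
  have hx2 : 1 ≤ x ^ 2 := one_le_pow₀ hx
  have hz : 1 / (4 * x ^ 2) ≤ 1 / 4 := by
    apply one_div_le_one_div_of_le <;> linarith
  have h := hasSum_centralBinom_div (by positivity) hz
  simp_rw [gamma_two_mul_div_eq_centralBinom]
  convert! h using 1
  have hs : 4 * (1 / (4 * x ^ 2)) = 1 / x ^ 2 := by field_simp
  rw [hs, show 1 / 2 + 1 / 2 * √(1 - 1 / x ^ 2) = (1 + √(1 - 1 / x ^ 2)) / 2 by ring,
    Real.log_div (by positivity) two_ne_zero]
  ring
end
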